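/- arXiv:1502.03891 — 3 statements merged into one kernel-verified Lean document; each statement's English description precedes it below -/
import Mathlib

section
/- For every integer l and real s, (D_s - b) τ_{l+1}·τ_l = -b c' g_{l+1}, i.e. τ_{l+1}'(s) τ_l(s) - τ_{l+1}(s) τ_l'(s) - b τ_{l+1}(s) τ_l(s) = -b c' g_{l+1}(s), where c' = Π_{i=1}^{2N} 2 p_i (1 - b p_i)/(1 + b p_i). (First identity of Lemma 2.2 of the paper.) -/
/-- The Pfaffian of a `2n × 2n` real matrix,
`Pf(B) = (1/(2^n n!)) Σ_{σ∈S_{2n}} sgn(σ) Π_{k=1}^n B_{σ(2k-1),σ(2k)}`. -/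
noncomputable def pfaffian (n : ℕ) (B : Matrix (Fin (2*n)) (Fin (2*n)) ℝ) : ℝ :=
  (1 / (2^n * (Nat.factorial n : ℝ))) *
    ∑ σ : Equiv.Perm (Fin (2*n)), ((Equiv.Perm.sign σ : ℤ) : ℝ) *
      ∏ k : Fin n, B (σ ⟨2*(k:ℕ), by have := k.isLt; omega⟩)
        (σ ⟨2*(k:ℕ)+1, by have := k.isLt; omega⟩)

open Matrix

noncomputable def pfs (n : ℕ) (B : Matrix (Fin n × Bool) (Fin n × Bool) ℝ) : ℝ :=
  (1 / (2^n * (Nat.factorial n : ℝ))) *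
    ∑ σ : Equiv.Perm (Fin n × Bool), ((Equiv.Perm.sign σ : ℤ) : ℝ) *
      ∏ k : Fin n, B (σ (k, false)) (σ (k, true))

noncomputable def dpfs (n : ℕ) (B H : Matrix (Fin n × Bool) (Fin n × Bool) ℝ) : ℝ :=
  (1 / (2^n * (Nat.factorial n : ℝ))) *
    ∑ σ : Equiv.Perm (Fin n × Bool), ((Equiv.Perm.sign σ : ℤ) : ℝ) *
      ∑ k : Fin n, (∏ j ∈ Finset.univ.erase k, B (σ (j, false)) (σ (j, true))) •
        H (σ (k, false)) (σ (k, true))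

theorem pfs_hasDerivAt (n : ℕ) (M : ℝ → Matrix (Fin n × Bool) (Fin n × Bool) ℝ)
    (M' : Matrix (Fin n × Bool) (Fin n × Bool) ℝ) (s : ℝ)
    (h : ∀ i j, HasDerivAt (fun t => M t i j) (M' i j) s) :
    HasDerivAt (fun t => pfs n (M t)) (dpfs n (M s) M') s := by
  unfold pfs dpfs
  refine HasDerivAt.const_mul _ (HasDerivAt.fun_sum fun σ _ => HasDerivAt.const_mul _ ?_)
  exact HasDerivAt.fun_finsetProd fun k _ => h _ _

theorem pfs_continuous (n : ℕ) : Continuous (pfs n) := by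
  unfold pfs
  fun_prop

theorem dpfs_continuous (n : ℕ) (H : Matrix (Fin n × Bool) (Fin n × Bool) ℝ) :
    Continuous (fun B => dpfs n B H) := by
  unfold dpfs
  fun_prop

def colEquiv (n : ℕ) : (Fin n → (Fin n × Bool) × (Fin n × Bool)) ≃ ((Fin n × Bool) → (Fin n × Bool)) where
  toFun f := fun x => if x.2 then (f x.1).2 else (f x.1).1
  invFun g := fun k => (g (k, false), g (k, true))
  left_inv f := by ext k <;> simp
  right_inv g := by
    funext x
    rcases x with ⟨k, r⟩
    cases r <;> simp

theorem pfs_congr (n : ℕ) (S B : Matrix (Fin n × Bool) (Fin n × Bool) ℝ) :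
    pfs n (S * B * Sᵀ) = S.det * pfs n B := by
  unfold pfs
  rw [mul_left_comm]
  congr 1
  have h1 : ∀ σ : Equiv.Perm (Fin n × Bool),
      ∏ k : Fin n, (S * B * Sᵀ) (σ (k, false)) (σ (k, true)) =
      ∑ g : (Fin n × Bool) → (Fin n × Bool), (∏ k : Fin n, B (g (k,false)) (g (k, true))) *
        ∏ x, S (σ x) (g x) := by
    intro σ
    have : ∀ k : Fin n, (S * B * Sᵀ) (σ (k, false)) (σ (k, true)) =
        ∑ q : (Fin n × Bool) × (Fin n × Bool), B q.1 q.2 * (S (σ (k,true)) q.2 * S (σ (k,false)) q.1) := by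
      intro k
      rw [Fintype.sum_prod_type_right]
      simp only [Matrix.mul_apply, Matrix.transpose_apply, Finset.sum_mul]
      refine Finset.sum_congr rfl fun x _ => Finset.sum_congr rfl fun y _ => ?_
      ring
    simp only [this]
    rw [Fintype.prod_sum]
    refine Fintype.sum_equiv (colEquiv n) _ _ fun f => ?_
    rw [Finset.prod_mul_distrib, Fintype.prod_prod_type]
    simp [colEquiv]
  simp only [h1, Finset.mul_sum]
  rw [Finset.sum_comm]
  symm
  refine Finset.sum_of_injOn (fun σ : Equiv.Perm (Fin n × Bool) => (σ : (Fin n × Bool) → (Fin n × Bool)))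
    (fun a _ b _ h => DFunLike.coe_injective h) (fun _ _ => by simp) ?_ ?_
  · intro g _ hg
    have hb : ¬ Function.Injective g := by
      intro hi
      apply hg
      exact ⟨Equiv.ofBijective g ((Finite.injective_iff_bijective).1 hi), by simp, rfl⟩
    simp only [Function.Injective] at hb
    push Not at hb
    obtain ⟨i, j, hij, hne⟩ := hb
    have := Matrix.det_zero_of_column_eq (M := S.submatrix id g) hne (by simp [hij])
    rw [Matrix.det_apply'] at this
    simp only [Matrix.submatrix_apply, id] at this
    calc _ = (∏ k : Fin n, B (g (k,false)) (g (k, true))) * ∑ i : Equiv.Perm (Fin n × Bool), ((Equiv.Perm.sign i : ℤ) : ℝ) * ∏ x, S (i x) (g x) := by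
          rw [Finset.mul_sum]
          exact Finset.sum_congr rfl fun _ _ => by ring
      _ = 0 := by rw [this, mul_zero]
  · intro g _
    have := Matrix.det_permute' g S
    rw [Matrix.det_apply'] at this
    simp only [Matrix.submatrix_apply, id] at this
    calc _ = (∏ k : Fin n, B (g (k,false)) (g (k, true))) * (((Equiv.Perm.sign g : ℤ) : ℝ) * S.det) := by ring
      _ = _ := by
          rw [← this, Finset.mul_sum]
          exact Finset.sum_congr rfl fun _ _ => by ring

def Kmat : Matrix Bool Bool ℝ := fun r r' => if r = r' then 0 else if r' then 1 else -1

def Jmat (n : ℕ) : Matrix (Fin n × Bool) (Fin n × Bool) ℝ := Matrix.kroneckerMap (· * ·) (1 : Matrix (Fin n) (Fin n) ℝ) Kmat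

theorem Kmat_det : Kmat.det = 1 := by
  rw [← Matrix.det_submatrix_equiv_self finTwoEquiv, Matrix.det_fin_two]
  simp [Kmat, finTwoEquiv]

theorem Jmat_det (n : ℕ) : (Jmat n).det = 1 := by
  unfold Jmat
  rw [Matrix.det_kronecker]
  simp [Kmat_det]

theorem Kmat_skew : Kmatᵀ = -Kmat := by
  ext a b
  cases a <;> cases b <;> simp [Kmat]

theorem Jmat_skew (n : ℕ) : (Jmat n)ᵀ = -Jmat n := by
  ext ⟨a, r⟩ ⟨b, t⟩
  have := congrFun (congrFun Kmat_skew r) t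
  simp only [Matrix.transpose_apply, Matrix.neg_apply] at this
  by_cases h : a = b
  · subst h; simp [Jmat, this]
  · simp [Jmat, h, Ne.symm h]

theorem Kmat_sign (τ : Equiv.Perm Bool) : Kmat (τ false) (τ true) = ((Equiv.Perm.sign τ : ℤ) : ℝ) := by
  have : ∀ τ : Equiv.Perm Bool, ((τ false = false ∧ τ true = true) ∧ Equiv.Perm.sign τ = 1) ∨
    ((τ false = true ∧ τ true = false) ∧ Equiv.Perm.sign τ = -1) := by decide
  rcases this τ with ⟨⟨h1, h2⟩, h3⟩ | ⟨⟨h1, h2⟩, h3⟩ <;> simp [h1, h2, h3, Kmat]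

def wr (n : ℕ) (q : Equiv.Perm (Fin n) × (Fin n → Equiv.Perm Bool)) : Equiv.Perm (Fin n × Bool) :=
  (Equiv.prodCongrRight q.2).trans (Equiv.prodCongrLeft fun _ => q.1)

theorem wr_apply (n : ℕ) (q) (k : Fin n) (r : Bool) : wr n q (k, r) = (q.1 k, q.2 k r) := rfl

theorem wr_inj (n : ℕ) : Function.Injective (wr n) := by
  intro q q' h
  have h2 : ∀ k r, wr n q (k, r) = wr n q' (k, r) := by simp [h]
  simp only [wr_apply, Prod.mk.injEq] at h2
  ext k
  · rw [(h2 k true).1]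
  · rw [(h2 k _).2]

theorem wr_sign (n : ℕ) (q) : Equiv.Perm.sign (wr n q) = ∏ k, Equiv.Perm.sign (q.2 k) := by
  unfold wr
  rw [Equiv.Perm.sign_trans, Equiv.Perm.sign_prodCongrRight, Equiv.Perm.sign_prodCongrLeft]
  simp

theorem wr_range (n : ℕ) (σ : Equiv.Perm (Fin n × Bool)) (h : ∀ k, (σ (k, false)).1 = (σ (k, true)).1) :
    ∃ q, wr n q = σ := by
  have h' : ∀ k r, (σ (k, r)).1 = (σ (k, true)).1 := by
    intro k r; cases r; exact h k; rfl
  have t : ∀ k, Function.Injective fun r => (σ (k, r)).2 := by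
    intro k r r' hr
    have : σ (k, r) = σ (k, r') := Prod.ext (by rw [h', h' k r']) hr
    simpa using this
  have t2 := fun k => (Finite.injective_iff_bijective).1 (t k)
  have m : Function.Injective fun k => (σ (k, true)).1 := by
    intro k k' hk
    obtain ⟨r, hr⟩ := (t2 k).2 (σ (k', true)).2
    have : σ (k, r) = σ (k', true) := Prod.ext (by rw [h']; exact hk) hr
    have := σ.injective this
    simp only [Prod.mk.injEq] at this
    exact this.1
  refine ⟨⟨Equiv.ofBijective _ ((Finite.injective_iff_bijective).1 m), fun k => Equiv.ofBijective _ (t2 k)⟩, ?_⟩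
  ext1 ⟨k, r⟩
  rw [wr_apply]
  exact Prod.ext (h' k r).symm rfl

theorem pfs_J (n : ℕ) : pfs n (Jmat n) = 1 := by
  unfold pfs
  have : ∑ q : Equiv.Perm (Fin n) × (Fin n → Equiv.Perm Bool), (1:ℝ) = 
    ∑ σ : Equiv.Perm (Fin n × Bool), ((Equiv.Perm.sign σ : ℤ) : ℝ) *
      ∏ k : Fin n, Jmat n (σ (k, false)) (σ (k, true)) := by
    refine Finset.sum_of_injOn (wr n) (wr_inj n).injOn (fun _ _ => by simp) ?_ ?_
    · intro σ _ hσ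
      have : ∃ k, (σ (k, false)).1 ≠ (σ (k, true)).1 := by
        by_contra! hh
        obtain ⟨q, hq⟩ := wr_range n σ hh
        exact hσ ⟨q, by simp, hq⟩
      obtain ⟨k, hk⟩ := this
      rw [Finset.prod_eq_zero (Finset.mem_univ k), mul_zero]
      simp [Jmat, Matrix.kroneckerMap, hk]
    · intro q _
      rw [wr_sign]
      simp only [wr_apply]
      have : ∀ k, Jmat n (q.1 k, q.2 k false) (q.1 k, q.2 k true) = ((Equiv.Perm.sign (q.2 k) : ℤ) : ℝ) := by
        intro k
        rw [← Kmat_sign]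
        simp [Jmat]
      simp only [this]
      push_cast
      rw [← Finset.prod_mul_distrib, Finset.prod_eq_one]
      intro k _
      rcases Int.units_eq_one_or (Equiv.Perm.sign (q.2 k)) with h | h <;> simp [h]
  rw [← this]
  have hp : Fintype.card (Equiv.Perm Bool) = 2 := by decide
  simp [Fintype.card_perm, hp]
  field_simp

/-- wedge -/
def wdg {ι : Type*} (x y : ι → ℝ) : Matrix ι ι ℝ := vecMulVec x y - vecMulVec y x

theorem wdg_skew {ι : Type*} (x y : ι → ℝ) : (wdg x y)ᵀ = - wdg x y := by
  ext i j; simp [wdg, vecMulVec_apply]; ring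

theorem skew_dot {ι : Type*} [Fintype ι] (B : Matrix ι ι ℝ) (hB : Bᵀ = -B) (x y : ι → ℝ) :
    x ⬝ᵥ (B *ᵥ y) = - (y ⬝ᵥ (B *ᵥ x)) := by
  rw [dotProduct_mulVec, ← mulVec_transpose, hB, neg_mulVec, neg_dotProduct, dotProduct_comm]

theorem wdg_congr {ι : Type*} [Fintype ι] [DecidableEq ι] (B : Matrix ι ι ℝ) (hB : Bᵀ = -B) (x r : ι → ℝ) :
    B + wdg x (B *ᵥ r) = (1 - vecMulVec x r) * B * (1 - vecMulVec x r)ᵀ := by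
  have h0 : r ⬝ᵥ (B *ᵥ r) = 0 := by have := skew_dot B hB r r; linarith
  have h1 : r ᵥ* B = - (B *ᵥ r) := by rw [← mulVec_transpose, hB, neg_mulVec]
  have h2 : (vecMulVec x r)ᵀ = vecMulVec r x := by ext i j; simp [vecMulVec_apply, mul_comm]
  rw [transpose_sub, h2, transpose_one, sub_mul, one_mul, mul_sub, mul_one, vecMulVec_mul, h1, sub_mul, mul_vecMulVec,
    vecMulVec_mul_vecMulVec, neg_dotProduct, dotProduct_comm, h0]
  ext i j; simp [wdg, vecMulVec_apply]; ring

theorem det_rk1 {ι : Type*} [Fintype ι] [DecidableEq ι] (x r : ι → ℝ) : (1 - vecMulVec x r).det = 1 - r ⬝ᵥ x := by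
  have := Matrix.det_one_add_replicateCol_mul_replicateRow (ι := Unit) (-x) r
  rw [dotProduct_neg, ← sub_eq_add_neg] at this
  rw [← this]
  congr 1
  ext i j
  simp [vecMulVec_apply, Matrix.mul_apply]
  ring

theorem pfs_wdg (n : ℕ) (B : Matrix (Fin n × Bool) (Fin n × Bool) ℝ) (hB : Bᵀ = -B) (x r : _ → ℝ) :
    pfs n (B + wdg x (B *ᵥ r)) = (1 - r ⬝ᵥ x) * pfs n B := by
  rw [wdg_congr B hB, pfs_congr, det_rk1]

theorem det_wdg {ι : Type*} [Fintype ι] [DecidableEq ι] (B : Matrix ι ι ℝ) (hB : Bᵀ = -B) (x r : _ → ℝ) :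
    (B + wdg x (B *ᵥ r)).det = (1 - r ⬝ᵥ x)^2 * B.det := by
  rw [wdg_congr B hB, det_mul, det_mul, det_transpose, det_rk1]; ring

theorem dens (n : ℕ) (B : Matrix (Fin n × Bool) (Fin n × Bool) ℝ) (f g : ℝ → ℝ) (hf : Continuous f) (hg : Continuous g)
    (h : ∀ ε : ℝ, (B + ε • Jmat n).det ≠ 0 → f ε = g ε) : f = g := by
  have hfin : {ε : ℝ | (B + ε • Jmat n).det = 0}.Finite := by
    have hJ : IsUnit (Jmat n).det := by simp [Jmat_det]
    have hm := Matrix.charpoly_monic (-((Jmat n)⁻¹ * B))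
    refine (Polynomial.finite_setOfPred_isRoot hm.ne_zero).subset ?_
    intro ε hε
    simp only [Set.mem_ofPred_eq, Polynomial.IsRoot.def] at hε ⊢
    rw [Matrix.eval_charpoly]
    have e1 : Matrix.scalar _ ε - -((Jmat n)⁻¹ * B) = (Jmat n)⁻¹ * (B + ε • Jmat n) := by
      rw [mul_add, Matrix.mul_smul, Matrix.nonsing_inv_mul _ hJ, sub_neg_eq_add, add_comm]
      congr 1
      simp [Matrix.smul_one_eq_diagonal]
    rw [e1, det_mul, hε, mul_zero]
  have hd : Dense {ε : ℝ | (B + ε • Jmat n).det = 0}ᶜ := hfin.countable.dense_compl ℝ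
  exact Continuous.ext_on hd hf hg fun ε hε => h ε hε

theorem skew_smul {ι : Type*} (B J : Matrix ι ι ℝ) (hB : Bᵀ = -B) (hJ : Jᵀ = -J) (t : ℝ) : (B + t • J)ᵀ = -(B + t • J) := by
  rw [transpose_add, transpose_smul, hB, hJ, smul_neg, neg_add]

theorem det_aux (n : ℕ) (c : (Fin n × Bool) × (Fin n × Bool) → ℝ) (S : Finset ((Fin n × Bool) × (Fin n × Bool))) :
    ∀ ε : ℝ, ((∑ a ∈ S, c a • wdg (Pi.single a.1 1) (Pi.single a.2 1)) + ε • Jmat n).det =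
      (pfs n ((∑ a ∈ S, c a • wdg (Pi.single a.1 1) (Pi.single a.2 1)) + ε • Jmat n))^2 := by
  classical
  induction S using Finset.induction_on with
  | empty =>
    intro ε
    have h : pfs n (ε • Jmat n) = ε ^ n := by
      have h1 : ∀ t : ℝ, pfs n (t • Jmat n) = t ^ n * pfs n (Jmat n) := by
        intro t
        unfold pfs
        simp only [Matrix.smul_apply, smul_eq_mul, Finset.prod_mul_distrib, Finset.mul_sum]
        refine Finset.sum_congr rfl fun _ _ => ?_
        simp; ring
      rw [h1, pfs_J, mul_one]
    simp only [Finset.sum_empty, zero_add, h, det_smul, Jmat_det]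
    simp
    ring
  | insert a S ha ih =>
    rw [Finset.sum_insert ha]
    set B := ∑ a ∈ S, c a • wdg (ι := Fin n × Bool) (Pi.single a.1 1) (Pi.single a.2 1) with hBdef
    have hB : Bᵀ = -B := by
      rw [hBdef, transpose_sum, ← Finset.sum_neg_distrib]
      refine Finset.sum_congr rfl fun _ _ => ?_
      rw [transpose_smul, wdg_skew, smul_neg]
    have hcont : Continuous fun ε : ℝ => c a • wdg (ι := Fin n × Bool) (Pi.single a.1 1) (Pi.single a.2 1) + B + ε • Jmat n := by fun_prop
    have := dens n B (fun ε => (c a • wdg (Pi.single a.1 1) (Pi.single a.2 1) + B + ε • Jmat n).det)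
      (fun ε => (pfs n (c a • wdg (Pi.single a.1 1) (Pi.single a.2 1) + B + ε • Jmat n))^2) hcont.matrix_det
      (((pfs_continuous n).comp hcont).pow 2) ?_
    · exact fun ε => congrFun this ε
    · intro ε hε
      have hs := skew_smul B _ hB (Jmat_skew n) ε
      set D := B + ε • Jmat n with hD
      have hy : c a • (Pi.single a.2 1 : Fin n × Bool → ℝ) = D *ᵥ (D⁻¹ *ᵥ (c a • (Pi.single a.2 1 : Fin n × Bool → ℝ))) := by
        rw [mulVec_mulVec, Matrix.mul_nonsing_inv _ (isUnit_iff_ne_zero.2 hε), one_mulVec]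
      have e : c a • wdg (Pi.single a.1 1) (Pi.single a.2 1) + B + ε • Jmat n =
          D + wdg (Pi.single a.1 1) (c a • (Pi.single a.2 1 : Fin n × Bool → ℝ)) := by
        rw [hD, add_assoc, add_comm]
        congr 1
        ext i j; simp [wdg, vecMulVec_apply]; ring
      rw [e, hy, pfs_wdg n D hs, det_wdg D hs, ih ε]
      ring

theorem det_eq_pfs_sq (n : ℕ) (B : Matrix (Fin n × Bool) (Fin n × Bool) ℝ) (hB : Bᵀ = -B) : B.det = (pfs n B)^2 := by
  have := det_aux n (fun a => (1/2) * B a.1 a.2) Finset.univ 0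
  have e : (∑ a : (Fin n × Bool) × (Fin n × Bool), ((1/2) * B a.1 a.2) • wdg (ι := Fin n × Bool) (Pi.single a.1 1) (Pi.single a.2 1)) = B := by
    ext i j
    have hij : B j i = - B i j := congrFun (congrFun hB i) j
    rw [Matrix.sum_apply, Fintype.sum_prod_type]
    simp [wdg, vecMulVec_apply, Pi.single_apply, mul_sub, Finset.sum_sub_distrib, hij]
    ring
  rw [e] at this
  simpa using this

theorem rk2_det {ι : Type*} [Fintype ι] [DecidableEq ι] (B : Matrix ι ι ℝ) (r₁ r₂ v₁ v₂ : ι → ℝ) :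
    (B + vecMulVec (B *ᵥ r₁) v₁ + vecMulVec (B *ᵥ r₂) v₂).det =
      B.det * ((1 + v₁ ⬝ᵥ r₁) * (1 + v₂ ⬝ᵥ r₂) - (v₁ ⬝ᵥ r₂) * (v₂ ⬝ᵥ r₁)) := by
  have e : B + vecMulVec (B *ᵥ r₁) v₁ + vecMulVec (B *ᵥ r₂) v₂ =
      B * (1 + (Matrix.of fun i (k : Fin 2) => ![r₁ i, r₂ i] k) * (Matrix.of fun (k : Fin 2) i => ![v₁ i, v₂ i] k)) := by
    rw [mul_add, mul_one, ← mul_vecMulVec, ← mul_vecMulVec, add_assoc, ← mul_add]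
    congr 2
    ext i j
    simp [Matrix.mul_apply, vecMulVec_apply]
  rw [e, det_mul, Matrix.det_one_add_mul_comm, Matrix.det_fin_two]
  simp [Matrix.mul_apply, dotProduct]

theorem dpfs_wdg (n : ℕ) (B : Matrix (Fin n × Bool) (Fin n × Bool) ℝ) (hB : Bᵀ = -B) (x r q : _ → ℝ) :
    dpfs n (B + wdg x (B *ᵥ r)) (wdg x (B *ᵥ q)) = - (q ⬝ᵥ x) * pfs n B := by
  have h1 := pfs_hasDerivAt n (fun t => B + wdg x (B *ᵥ r) + t • wdg x (B *ᵥ q)) (wdg x (B *ᵥ q)) 0 (by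
    intro i j
    simp only [Matrix.add_apply, Matrix.smul_apply, smul_eq_mul]
    simpa using ((hasDerivAt_id (0:ℝ)).mul_const (wdg x (B *ᵥ q) i j)).const_add (B i j + wdg x (B *ᵥ r) i j))
  have h2 : (fun t : ℝ => pfs n (B + wdg x (B *ᵥ r) + t • wdg x (B *ᵥ q))) =
      fun t => (1 - r ⬝ᵥ x - t * (q ⬝ᵥ x)) * pfs n B := by
    funext t
    have : B + wdg x (B *ᵥ r) + t • wdg x (B *ᵥ q) = B + wdg x (B *ᵥ (r + t • q)) := by
      rw [mulVec_add, mulVec_smul]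
      ext i j; simp [wdg, vecMulVec_apply]; ring
    rw [this, pfs_wdg n B hB]
    rw [add_dotProduct, smul_dotProduct, smul_eq_mul]; ring
  rw [h2] at h1
  have h3 : HasDerivAt (fun t : ℝ => (1 - r ⬝ᵥ x - t * (q ⬝ᵥ x)) * pfs n B) (- (q ⬝ᵥ x) * pfs n B) 0 := by
    have := (((hasDerivAt_id (0:ℝ)).mul_const (q ⬝ᵥ x)).const_sub (1 - r ⬝ᵥ x)).mul_const (pfs n B)
    simpa using this
  have := h1.unique h3
  simpa using this

theorem key_inv (n : ℕ) (b : ℝ) (hb : b ≠ 0) (B : Matrix (Fin n × Bool) (Fin n × Bool) ℝ) (hB : Bᵀ = -B)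
    (hd : B.det ≠ 0) (u v w : Fin n × Bool → ℝ) :
    dpfs n B (wdg v w) * pfs n (B - wdg v u) - pfs n B * dpfs n (B - wdg v u) (wdg u (w - b • (u + v)))
      - b * (pfs n B * pfs n (B - wdg v u)) =
    -b * (B + vecMulVec v v + vecMulVec ((-(1/b)) • (v - u)) w).det := by
  have hy : ∀ y : Fin n × Bool → ℝ, ∃ r, y = B *ᵥ r := fun y => ⟨B⁻¹ *ᵥ y, by
    rw [mulVec_mulVec, Matrix.mul_nonsing_inv _ (isUnit_iff_ne_zero.2 hd), one_mulVec]⟩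
  obtain ⟨x, rfl⟩ := hy u
  obtain ⟨y, rfl⟩ := hy v
  obtain ⟨z, rfl⟩ := hy w
  have e1 : dpfs n B (wdg (B *ᵥ y) (B *ᵥ z)) = - (z ⬝ᵥ (B *ᵥ y)) * pfs n B := by
    have := dpfs_wdg n B hB (B *ᵥ y) 0 z
    rw [mulVec_zero] at this
    have h0 : wdg (B *ᵥ y) (0 : Fin n × Bool → ℝ) = 0 := by ext i j; simp [wdg, vecMulVec_apply]
    rwa [h0, add_zero] at this
  have e0 : B - wdg (B *ᵥ y) (B *ᵥ x) = B + wdg (B *ᵥ x) (B *ᵥ y) := by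
    ext i j; simp [wdg, vecMulVec_apply]; ring
  have e2 : B *ᵥ z - b • (B *ᵥ x + B *ᵥ y) = B *ᵥ (z - b • (x + y)) := by
    rw [mulVec_sub, mulVec_smul, mulVec_add]
  have e3 : (-(1/b)) • (B *ᵥ y - B *ᵥ x) = B *ᵥ ((-(1/b)) • (y - x)) := by
    rw [mulVec_smul, mulVec_sub]
  rw [e1, e0, pfs_wdg n B hB, e2, dpfs_wdg n B hB, e3, rk2_det, det_eq_pfs_sq n B hB]
  have hxx : x ⬝ᵥ (B *ᵥ x) = 0 := by have := skew_dot B hB x x; linarith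
  have hyy : y ⬝ᵥ (B *ᵥ y) = 0 := by have := skew_dot B hB y y; linarith
  have hxy := skew_dot B hB x y
  have hxz := skew_dot B hB x z
  have hyz := skew_dot B hB y z
  simp only [sub_dotProduct, smul_dotProduct, add_dotProduct, dotProduct_smul, dotProduct_sub, smul_eq_mul,
    dotProduct_comm (B *ᵥ y) _, dotProduct_comm (B *ᵥ z) _, hxx, hyy, hxz, hyz, hxy]
  field_simp
  ring

theorem key (n : ℕ) (b : ℝ) (hb : b ≠ 0) (B : Matrix (Fin n × Bool) (Fin n × Bool) ℝ) (hB : Bᵀ = -B)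
    (u v w : Fin n × Bool → ℝ) :
    dpfs n B (wdg v w) * pfs n (B - wdg v u) - pfs n B * dpfs n (B - wdg v u) (wdg u (w - b • (u + v)))
      - b * (pfs n B * pfs n (B - wdg v u)) =
    -b * (B + vecMulVec v v + vecMulVec ((-(1/b)) • (v - u)) w).det := by
  have hc : Continuous fun ε : ℝ => B + ε • Jmat n := by fun_prop
  have hc2 : Continuous fun ε : ℝ => B + ε • Jmat n - wdg v u := by fun_prop
  have hc3 : Continuous fun ε : ℝ => B + ε • Jmat n + vecMulVec v v + vecMulVec ((-(1/b)) • (v - u)) w := by fun_prop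
  have p1 := (pfs_continuous n).comp hc
  have p2 := (pfs_continuous n).comp hc2
  have d1 := (dpfs_continuous n (wdg v w)).comp hc
  have d2 := (dpfs_continuous n (wdg u (w - b • (u + v)))).comp hc2
  have := dens n B _ _ (((d1.mul p2).sub (p1.mul d2)).sub ((p1.mul p2).const_mul b)) (hc3.matrix_det.const_mul (-b))
    (fun ε hε => key_inv n b hb _ (skew_smul B _ hB (Jmat_skew n) ε) hε u v w)
  have := congrFun this 0
  simpa using this

def eqv (n : ℕ) : Fin n × Bool ≃ Fin (2*n) where
  toFun x := ⟨2 * (x.1 : ℕ) + (if x.2 then 1 else 0), by have := x.1.isLt; split_ifs <;> omega⟩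
  invFun i := (⟨(i:ℕ)/2, by have := i.isLt; omega⟩, decide ((i:ℕ) % 2 = 1))
  left_inv x := by
    rcases x with ⟨k, r⟩
    cases r
    · simp
    · ext
      · simp; omega
      · simp
  right_inv i := by
    ext
    simp only [decide_eq_true_eq]
    split_ifs <;> omega

theorem scal (b p q y z C : ℝ) (hb : b ≠ 0) (h : 1 + b * p ≠ 0) (hp : p ≠ 0) (hq : q ≠ 0) (hpq : p + q ≠ 0) :
    -C * (2 * p ^ 2 / q) * ((1 - b * q) / (1 + b * p)) +
      (p - q) / (p + q) * ((1 + b * p) * y) * ((1 + b * q) * z) + (1 + b * p) * y * ((1 + b * q) * z) +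
      -(1 / b) * ((1 + b * p) * y - (1 - b * p) * y) * ((1 + b * q) * z / q) =
    -2 * p ^ 2 / (1 + b * p) * (C + (1 + b * p) * y * ((1 + b * q) * z) / (p + q)) * ((1 - b * q) / q) := by
  have h' : 1 + p * b ≠ 0 := by rwa [mul_comm]
  field_simp
  ring

theorem pfaffian_eq (n : ℕ) (B : Matrix (Fin (2*n)) (Fin (2*n)) ℝ) :
    pfaffian n B = pfs n (B.submatrix (eqv n) (eqv n)) := by
  unfold pfaffian pfs
  congr 1
  symm
  refine Fintype.sum_equiv (eqv n).permCongr _ _ fun σ => ?_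
  rw [Equiv.Perm.sign_permCongr]
  congr 1
  refine Finset.prod_congr rfl fun k _ => ?_
  have h1 : (⟨2*(k:ℕ), by have := k.isLt; omega⟩ : Fin (2*n)) = eqv n (k, false) := by ext; simp [eqv]
  have h2 : (⟨2*(k:ℕ)+1, by have := k.isLt; omega⟩ : Fin (2*n)) = eqv n (k, true) := by ext; simp [eqv]
  rw [h1, h2]
  simp [Equiv.permCongr_apply]

set_option maxHeartbeats 1000000 in
/-- First identity of Lemma 2.2: `(D_s - b) τ_{l+1}·τ_l = -b c' g_{l+1}`. -/
theorem stmt4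
    (N : ℕ) (hN : 1 ≤ N) (b : ℝ) (hb : b ≠ 0)
    (p : Fin (2*N) → ℝ) (hp0 : ∀ i, p i ≠ 0)
    (hpsum : ∀ i j, p i + p j ≠ 0)
    (hbm : ∀ i, 1 - b * p i ≠ 0) (hbp : ∀ i, 1 + b * p i ≠ 0)
    (ξ : Fin (2*N) → ℝ)
    (φ : Fin (2*N) → ℤ → ℤ → ℝ → ℝ)
    (hφ : ∀ i n l s, φ i n l s =
      p i ^ n * ((1 + b * p i) / (1 - b * p i)) ^ l * Real.exp (s / p i + ξ i))
    (c : Fin (2*N) → ℝ) (hc : ∀ i, c i.rev = c i)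
    (C : Matrix (Fin (2*N)) (Fin (2*N)) ℝ)
    (hC : ∀ i j, C i j = if j = i.rev then c i else 0)
    (cc : Matrix (Fin (2*N)) (Fin (2*N)) ℝ)
    (hcc : ∀ i j, cc i j = -C i j * (2 * (p i)^2 / p j) * ((1 - b * p j) / (1 + b * p i)))
    (hred : ∀ i, (p i)^3 * (1 - b^2 * (p i.rev)^2) = -(p i.rev)^3 * (1 - b^2 * (p i)^2))
    (g : ℤ → ℝ → ℝ)
    (hg : ∀ l s, g l s =
      Matrix.det (Matrix.of fun i j => C i j + φ i 0 l s * φ j 0 l s / (p i + p j)))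
    (τ : ℤ → ℝ → ℝ)
    (hτ : ∀ l s, τ l s = pfaffian N (Matrix.of fun i j =>
      cc i j + ((p i - p j) / (p i + p j)) * φ i 0 l s * φ j 0 l s))
    (l : ℤ) (s : ℝ) :
    deriv (τ (l+1)) s * τ l s - τ (l+1) s * deriv (τ l) s - b * (τ (l+1) s * τ l s)
      = -b * (∏ i, 2 * p i * ((1 - b * p i) / (1 + b * p i))) * g (l+1) s := by
  have hne : ∀ i : Fin (2*N), i.rev ≠ i := by
    intro i h
    have := congrArg Fin.val h
    rw [Fin.val_rev] at this
    omega
  have hccskew : ∀ i j, cc j i = - cc i j := by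
    intro i j
    rw [hcc, hcc, hC, hC]
    by_cases h : j = i.rev
    · subst h
      have h3 := hred i
      have a1 := hp0 i
      have a2 := hp0 i.rev
      have a3 := hbp i
      have a4 := hbp i.rev
      simp only [Fin.rev_rev, if_true, hc]
      generalize p i.rev = q at *
      generalize p i = r at *
      rw [neg_mul, neg_mul, neg_mul, neg_mul, neg_neg, mul_assoc, mul_assoc, ← mul_neg, div_mul_div_comm, div_mul_div_comm]
      congr 1
      rw [neg_eq_iff_eq_neg, ← neg_div, div_eq_div_iff (mul_ne_zero a1 a4) (mul_ne_zero a2 a3)]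
      linear_combination 2 * h3
    · have h' : ¬ i = j.rev := fun h' => h (by rw [h', Fin.rev_rev])
      simp [h, h']
  have hstep : ∀ i, φ i 0 (l+1) s = φ i 0 l s * ((1 + b * p i) / (1 - b * p i)) := by
    intro i
    rw [hφ, hφ, zpow_add_one₀ (div_ne_zero (hbp i) (hbm i))]
    ring
  have hy : ∀ i, ∃ y, φ i 0 l s = (1 - b * p i) * y ∧ φ i 0 (l+1) s = (1 + b * p i) * y := by
    intro i
    refine ⟨φ i 0 l s / (1 - b * p i), (mul_div_cancel₀ _ (hbm i)).symm, ?_⟩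
    rw [hstep]; ring
  set e := eqv N with he
  set A : ℤ → ℝ → Matrix (Fin N × Bool) (Fin N × Bool) ℝ := fun l s => Matrix.of fun x y =>
      cc (e x) (e y) + ((p (e x) - p (e y)) / (p (e x) + p (e y))) * φ (e x) 0 l s * φ (e y) 0 l s with hA
  have hτ' : ∀ l, τ l = fun s => pfs N (A l s) := by
    intro l; funext s
    rw [hτ, pfaffian_eq]
    rfl
  have hder : ∀ l, deriv (τ l) s = dpfs N (A l s) (wdg (fun x => φ (e x) 0 l s) (fun x => φ (e x) 0 l s / p (e x))) := by
    intro l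
    rw [hτ']
    apply HasDerivAt.deriv
    apply pfs_hasDerivAt N (A l)
    intro x y
    have hd : ∀ i, HasDerivAt (φ i 0 l) (φ i 0 l s / p i) s := by
      intro i
      have h1 : φ i 0 l = fun s => p i ^ (0:ℤ) * ((1 + b * p i) / (1 - b * p i)) ^ l * Real.exp (s / p i + ξ i) :=
        funext fun s => hφ i 0 l s
      have := ((((hasDerivAt_id s).div_const (p i)).add_const (ξ i)).exp).const_mul (p i ^ (0:ℤ) * ((1 + b * p i) / (1 - b * p i)) ^ l)
      rw [hφ i 0 l s, h1]
      refine this.congr_deriv ?_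
      simp only [id]
      ring
    have h2 := (((hd (e x)).const_mul ((p (e x) - p (e y)) / (p (e x) + p (e y)))).mul (hd (e y))).const_add (cc (e x) (e y))
    refine h2.congr_deriv ?_
    have a1 := hp0 (e x)
    have a2 := hp0 (e y)
    have a3 := hpsum (e x) (e y)
    simp only [wdg, Matrix.sub_apply, vecMulVec_apply]
    field_simp
    ring
  set u : Fin N × Bool → ℝ := fun x => φ (e x) 0 l s with hu
  set v : Fin N × Bool → ℝ := fun x => φ (e x) 0 (l+1) s with hv
  set w : Fin N × Bool → ℝ := fun x => φ (e x) 0 (l+1) s / p (e x) with hw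
  have hskew : (A (l+1) s)ᵀ = - A (l+1) s := by
    ext x y
    have a3 := hpsum (e x) (e y)
    have a4 := hpsum (e y) (e x)
    simp only [hA, Matrix.transpose_apply, Matrix.neg_apply, Matrix.of_apply, hccskew (e x) (e y)]
    field_simp
    ring
  have hAl : A l s = A (l+1) s - wdg v u := by
    ext x y
    have a3 := hpsum (e x) (e y)
    have a4 := hbm (e x)
    have a5 := hbm (e y)
    simp only [hA, hu, hv, wdg, vecMulVec_apply, Matrix.of_apply, Matrix.sub_apply]
    obtain ⟨y1, h1, h2⟩ := hy (e x)
    obtain ⟨y2, h3, h4⟩ := hy (e y)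
    rw [h1, h2, h3, h4]
    field_simp
    ring
  have hq : (fun x => φ (e x) 0 l s / p (e x)) = w - b • (u + v) := by
    funext x
    have a4 := hbm (e x)
    have a1 := hp0 (e x)
    simp only [hu, hv, hw, Pi.sub_apply, Pi.smul_apply, Pi.add_apply, smul_eq_mul]
    obtain ⟨y1, h1, h2⟩ := hy (e x)
    rw [h1, h2]
    field_simp
    ring
  have hdet : (∏ i, 2 * p i * ((1 - b * p i) / (1 + b * p i))) * g (l+1) s =
      (A (l+1) s + vecMulVec v v + vecMulVec ((-(1/b)) • (v - u)) w).det := by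
    rw [hg]
    have hE : A (l+1) s + vecMulVec v v + vecMulVec ((-(1/b)) • (v - u)) w =
      (Matrix.diagonal (fun i => -2 * p i ^ 2 / (1 + b * p i)) *
        (Matrix.of fun i j => C i j + φ i 0 (l+1) s * φ j 0 (l+1) s / (p i + p j)) *
        Matrix.diagonal (fun i => (1 - b * p i) / p i)).submatrix e e := by
      ext x y
      have a3 := hpsum (e x) (e y)
      have a4 := hbm (e x)
      have a5 := hbm (e y)
      have a6 := hbp (e x)
      have a7 := hbp (e y)
      have a1 := hp0 (e x)
      have a2 := hp0 (e y)
      rw [Matrix.submatrix_apply, Matrix.mul_diagonal, Matrix.diagonal_mul]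
      simp only [hA, hu, hv, hw, vecMulVec_apply, Matrix.of_apply, Matrix.add_apply, hcc,
        Pi.sub_apply, Pi.smul_apply, smul_eq_mul]
      obtain ⟨y1, h1, h2⟩ := hy (e x)
      obtain ⟨y2, h3, h4⟩ := hy (e y)
      rw [h1, h2, h4]
      exact scal _ _ _ _ _ _ hb a6 a1 a2 a3
    rw [hE, Matrix.det_submatrix_equiv_self, det_mul, det_mul, det_diagonal, det_diagonal, mul_right_comm,
      ← Finset.prod_mul_distrib]
    congr 1
    have : ∏ i : Fin (2*N), (-1:ℝ) = 1 := by simp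
    rw [← one_mul (∏ i, 2 * p i * ((1 - b * p i) / (1 + b * p i))), ← this, ← Finset.prod_mul_distrib]
    refine Finset.prod_congr rfl fun i _ => ?_
    have a1 := hp0 i
    have a6 := hbp i
    field_simp
  rw [mul_assoc, hdet, hder, hder, hτ', hτ', hq]
  simp only
  rw [hAl]
  exact key N b hb _ hskew u v w
end

section
/- For every integer l and real s, τ_l(s)² = c' f_l(s), where c' = Π_{i=1}^{2N} 2 p_i (1 - b p_i)/(1 + b p_i). (Second identity of Lemma 2.2 of the paper.) -/
open Matrix in
/-- Standard symplectic matrix. -/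
noncomputable def Jst (n : ℕ) : Matrix (Fin 2 × Fin n) (Fin 2 × Fin n) ℝ :=
  Matrix.blockDiagonal (fun _ => !![0, 1; -1, 0])

/-- Unnormalised Pfaffian sum on a product index. -/
noncomputable def pfS (n : ℕ) (B : Matrix (Fin 2 × Fin n) (Fin 2 × Fin n) ℝ) : ℝ :=
  ∑ σ : Equiv.Perm (Fin 2 × Fin n), ((Equiv.Perm.sign σ : ℤ) : ℝ) *
      ∏ k : Fin n, B (σ (0, k)) (σ (1, k))

lemma Jst_det (n : ℕ) : (Jst n).det = 1 := by
  rw [Jst, Matrix.det_blockDiagonal]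
  simp [Matrix.det_fin_two]

/-- Index equivalence. -/
def idxE (n : ℕ) : Fin 2 × Fin n ≃ Fin (2 * n) :=
  (Equiv.prodComm _ _).trans (finProdFinEquiv.trans (finCongr (Nat.mul_comm n 2)))

lemma pfaffian_eq_s5 (n : ℕ) (B : Matrix (Fin (2*n)) (Fin (2*n)) ℝ) :
    pfaffian n B = (1 / (2^n * (Nat.factorial n : ℝ))) *
      pfS n (B.submatrix (idxE n) (idxE n)) := by
  unfold pfaffian pfS
  congr 1
  refine (Fintype.sum_equiv (idxE n).permCongr _ _ ?_).symm
  intro σ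
  rw [Equiv.Perm.sign_permCongr]
  congr 1
  refine Finset.prod_congr rfl fun k _ => ?_
  have h0 : (idxE n).symm ⟨2*(k:ℕ), by have := k.isLt; omega⟩ = (0, k) := by
    rw [Equiv.symm_apply_eq]; ext; simp [idxE]
  have h1 : (idxE n).symm ⟨2*(k:ℕ)+1, by have := k.isLt; omega⟩ = (1, k) := by
    rw [Equiv.symm_apply_eq]; ext; simp [idxE]; omega
  simp [Equiv.permCongr_apply, h0, h1]

lemma pfS_expand (n : ℕ) (Q B : Matrix (Fin 2 × Fin n) (Fin 2 × Fin n) ℝ) :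
    pfS n (Q * B * Q.transpose) = Q.det *
      ∑ h : Fin n → (Fin 2 × Fin n) × (Fin 2 × Fin n), (∏ k, B (h k).1 (h k).2) *
        ((1 : Matrix (Fin 2 × Fin n) (Fin 2 × Fin n) ℝ).submatrix id
          (fun x => if x.1 = 0 then (h x.2).1 else (h x.2).2)).det := by
  unfold pfS
  have key : ∀ σ : Equiv.Perm (Fin 2 × Fin n),
      ∏ k : Fin n, (Q * B * Q.transpose) (σ (0, k)) (σ (1, k)) =
      ∑ h : Fin n → (Fin 2 × Fin n) × (Fin 2 × Fin n), (∏ k, B (h k).1 (h k).2) *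
        ∏ x, Q (σ x) (if x.1 = 0 then (h x.2).1 else (h x.2).2) := by
    intro σ
    have h1 : ∀ k : Fin n, (Q * B * Q.transpose) (σ (0, k)) (σ (1, k)) =
        ∑ ab : (Fin 2 × Fin n) × (Fin 2 × Fin n),
          B ab.1 ab.2 * (Q (σ (0, k)) ab.1 * Q (σ (1, k)) ab.2) := by
      intro k
      rw [Fintype.sum_prod_type_right]
      simp only [Matrix.mul_apply, Matrix.transpose_apply, Finset.sum_mul]
      refine Finset.sum_congr rfl fun _ _ => Finset.sum_congr rfl fun _ _ => by ring
    simp only [h1]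
    rw [Finset.prod_univ_sum, Fintype.piFinset_univ]
    refine Finset.sum_congr rfl fun h _ => ?_
    rw [Finset.prod_mul_distrib]
    congr 1
    rw [Fintype.prod_prod_type_right]
    refine Finset.prod_congr rfl fun k _ => ?_
    simp [Fin.prod_univ_two]
  simp only [key, Finset.mul_sum]
  rw [Finset.sum_comm]
  refine Finset.sum_congr rfl fun h _ => ?_
  have h2 : ∀ g : Fin 2 × Fin n → Fin 2 × Fin n,
      ∑ σ : Equiv.Perm (Fin 2 × Fin n), ((Equiv.Perm.sign σ : ℤ) : ℝ) * ∏ x, Q (σ x) (g x)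
      = Q.det * ((1 : Matrix (Fin 2 × Fin n) (Fin 2 × Fin n) ℝ).submatrix id g).det := by
    intro g
    rw [← Matrix.det_mul]
    have : Q * (1 : Matrix (Fin 2 × Fin n) (Fin 2 × Fin n) ℝ).submatrix id g
        = Q.submatrix id g := by
      ext i j; simp [Matrix.mul_apply, Matrix.one_apply]
    rw [this, Matrix.det_apply']
    rfl
  rw [mul_left_comm, ← h2, Finset.mul_sum]
  refine Finset.sum_congr rfl fun σ _ => by ring

lemma pfS_congr (n : ℕ) (Q B : Matrix (Fin 2 × Fin n) (Fin 2 × Fin n) ℝ) :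
    pfS n (Q * B * Q.transpose) = Q.det * pfS n B := by
  have h := pfS_expand n 1 B
  simp only [Matrix.det_one, one_mul, Matrix.transpose_one, mul_one] at h
  rw [pfS_expand, h]

/-- Permutations preserving the blocks. -/
def blkP (n : ℕ) (x : Equiv.Perm (Fin n) × (Fin n → Equiv.Perm (Fin 2))) :
    Equiv.Perm (Fin 2 × Fin n) :=
  (Equiv.prodCongrLeft x.2).trans (Equiv.prodCongrRight fun _ => x.1)

lemma blkP_apply (n : ℕ) (x) (b : Fin 2) (k : Fin n) : blkP n x (b, k) = (x.2 k b, x.1 k) := rfl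

lemma blkP_inj (n : ℕ) : Function.Injective (blkP n) := by
  intro x y h
  have h' : ∀ b k, (x.2 k b, x.1 k) = (y.2 k b, y.1 k) := fun b k => by
    rw [← blkP_apply, ← blkP_apply, h]
  refine Prod.ext (Equiv.ext fun k => ?_) (funext fun k => Equiv.ext fun b => ?_)
  · exact (Prod.ext_iff.1 (h' 0 k)).2
  · exact (Prod.ext_iff.1 (h' b k)).1

lemma fin2_sign (e : Equiv.Perm (Fin 2)) :
    (!![0, 1; -1, 0] : Matrix (Fin 2) (Fin 2) ℝ) (e 0) (e 1) = ((Equiv.Perm.sign e : ℤ) : ℝ) := by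
  have h : ∀ e : Equiv.Perm (Fin 2), (!![0, 1; -1, 0] : Matrix (Fin 2) (Fin 2) ℤ) (e 0) (e 1)
     = (Equiv.Perm.sign e : ℤ) := by decide
  rw [← h e]
  generalize e 0 = a
  generalize e 1 = c
  fin_cases a <;> fin_cases c <;> simp

lemma pfS_J (n : ℕ) : pfS n (Jst n) = 2^n * (Nat.factorial n : ℝ) := by
  unfold pfS
  rw [← Finset.sum_subset (Finset.subset_univ (Finset.univ.map ⟨blkP n, blkP_inj n⟩))]
  · rw [Finset.sum_map]
    have : ∀ x, ((Equiv.Perm.sign (blkP n x) : ℤ) : ℝ) *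
      ∏ k : Fin n, Jst n (blkP n x (0, k)) (blkP n x (1, k)) = 1 := by
      intro x
      have h1 : ∏ k : Fin n, Jst n (blkP n x (0, k)) (blkP n x (1, k)) =
          ((((∏ k, Equiv.Perm.sign (x.2 k) : ℤˣ) : ℤ)) : ℝ) := by
        rw [Units.coe_prod, Int.cast_prod]
        refine Finset.prod_congr rfl fun k _ => ?_
        rw [blkP_apply, blkP_apply, Jst, Matrix.blockDiagonal_apply, if_pos rfl]
        exact fin2_sign _
      have h2 : Equiv.Perm.sign (blkP n x) = ∏ k, Equiv.Perm.sign (x.2 k) := by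
        have : blkP n x = (Equiv.prodCongrRight fun _ => x.1) * (Equiv.prodCongrLeft x.2) := rfl
        rw [this, Equiv.Perm.sign_mul, Equiv.Perm.sign_prodCongrRight,
          Equiv.Perm.sign_prodCongrLeft]
        simp
      rw [h1, h2]
      rw [← Int.cast_mul, ← Units.val_mul, ← sq, Int.units_sq]
      simp
    simp only [Function.Embedding.coeFn_mk, this]
    simp [Fintype.card_perm, mul_comm]
  · intro σ _ hσ
    by_contra hne
    apply hσ
    have hp : ∀ k, (σ (0, k)).2 = (σ (1, k)).2 := by
      intro k
      by_contra hk
      apply hne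
      apply mul_eq_zero_of_right
      apply Finset.prod_eq_zero (Finset.mem_univ k)
      rw [Jst, Matrix.blockDiagonal_apply, if_neg hk]
    have hp' : ∀ b k, (σ (b, k)).2 = (σ (0, k)).2 := by
      intro b k
      fin_cases b
      · rfl
      · exact (hp k).symm
    have hs : Function.Bijective (fun k => (σ (0, k)).2) := by
      rw [← Finite.surjective_iff_bijective]
      intro j
      obtain ⟨⟨b, k⟩, hbk⟩ := σ.surjective (0, j)
      refine ⟨k, ?_⟩
      show (σ (0, k)).2 = j
      rw [← hp' b k, hbk]
    have hi : ∀ k, Function.Bijective (fun b => (σ (b, k)).1) := by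
      intro k
      rw [← Finite.injective_iff_bijective]
      intro b b' h
      have := σ.injective (Prod.ext h ((hp' b k).trans (hp' b' k).symm))
      exact (Prod.ext_iff.1 this).1
    rw [Finset.mem_map]
    refine ⟨(Equiv.ofBijective _ hs, fun k => Equiv.ofBijective _ (hi k)), Finset.mem_univ _, ?_⟩
    refine Equiv.ext fun ⟨b, k⟩ => ?_
    refine Prod.ext rfl ?_
    exact (hp' b k).symm

lemma skew_decomp {ι : Type*} [Fintype ι] [DecidableEq ι] (n : ℕ) :
    ∀ (S : Finset ι) (A : ι → ι → ℝ), S.card ≤ 2 * n → (∀ i j, A j i = - A i j) →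
    (∀ i j, i ∉ S → A i j = 0) →
    ∃ u v : Fin n → ι → ℝ, ∀ i j, A i j = ∑ k, (u k i * v k j - v k i * u k j) := by
  induction n with
  | zero =>
    intro S A hS _ h0
    have : S = ∅ := by simpa using hS
    subst this
    exact ⟨fun _ _ => 0, fun _ _ => 0, fun i j => by simp [h0]⟩
  | succ n ih =>
    intro S A hS hA h0
    by_cases hz : ∀ i j, A i j = 0
    · exact ⟨fun _ _ => 0, fun _ _ => 0, fun i j => by simp [hz]⟩
    push Not at hz
    obtain ⟨i, j, ha⟩ := hz
    have hd : ∀ i, A i i = 0 := fun i => by have := hA i i; linarith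
    have hij : i ≠ j := by rintro rfl; exact ha (hd i)
    have hiS : i ∈ S := by by_contra h; exact ha (h0 i j h)
    have hjS : j ∈ S := by
      by_contra h; apply ha; rw [hA j i, h0 j i h, neg_zero]
    have hcard : ((S.erase i).erase j).card ≤ 2 * n := by
      rw [Finset.card_erase_of_mem (Finset.mem_erase.2 ⟨hij.symm, hjS⟩),
        Finset.card_erase_of_mem hiS]
      omega
    obtain ⟨u, v, huv⟩ := ih ((S.erase i).erase j)
      (fun k l => A k l - (A k i / A i j * A l j - A k j * (A l i / A i j))) hcard
      (fun k l => by simp only [hA k l]; ring)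
      (fun k l hk => by
        by_cases hkj : k = j
        · subst hkj; simp only [hd, hA i k, hA k l]; field_simp; ring
        by_cases hki : k = i
        · subst hki; simp only [hd, hA k l]; field_simp; ring
        have hkS : k ∉ S := by simpa [hkj, hki] using hk
        simp [h0 k _ hkS])
    refine ⟨Fin.cons (fun k => A k i / A i j) u, Fin.cons (fun k => A k j) v, fun k l => ?_⟩
    rw [Fin.sum_univ_succ]
    simp only [Fin.cons_zero, Fin.cons_succ]
    rw [← huv k l]; ring

lemma pf_sq (n : ℕ) (B : Matrix (Fin (2*n)) (Fin (2*n)) ℝ) (hB : ∀ i j, B j i = - B i j) :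
    (pfaffian n B)^2 = B.det := by
  rw [pfaffian_eq_s5, ← Matrix.det_submatrix_equiv_self (idxE n)]
  set A := B.submatrix (idxE n) (idxE n) with hAdef
  obtain ⟨u, v, huv⟩ := skew_decomp n Finset.univ A (by simp) (fun i j => hB _ _) (by simp)
  let Q : Matrix (Fin 2 × Fin n) (Fin 2 × Fin n) ℝ :=
    Matrix.of fun i x => if x.1 = 0 then u x.2 i else v x.2 i
  have hA : A = Q * Jst n * Q.transpose := by
    ext i j
    rw [huv i j]
    simp only [Matrix.mul_apply, Matrix.transpose_apply, Jst, Matrix.blockDiagonal_apply]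
    simp only [Fintype.sum_prod_type_right, Fin.sum_univ_two]
    refine Finset.sum_congr rfl fun k _ => ?_
    simp [Q]
    ring
  rw [hA, pfS_congr, pfS_J, Matrix.det_mul, Matrix.det_mul, Jst_det, Matrix.det_transpose]
  have : (2^n * (Nat.factorial n : ℝ)) ≠ 0 := by positivity
  field_simp

lemma det_skew_odd {ι : Type*} [Fintype ι] [DecidableEq ι] (M : Matrix ι ι ℝ)
    (hM : M.transpose = - M) (ho : Odd (Fintype.card ι)) : M.det = 0 := by
  have h := Matrix.det_transpose M
  rw [hM, Matrix.det_neg, ho.neg_one_pow] at h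
  linarith

lemma det_skew_rank1 {ι : Type*} [Fintype ι] [DecidableEq ι] (A : Matrix ι ι ℝ) (v : ι → ℝ)
    (hA : A.transpose = - A) (he : Even (Fintype.card ι)) :
    (Matrix.of fun i j => A i j + v i * v j).det = A.det := by
  let R : Matrix Unit ι ℝ := Matrix.of fun _ j => - v j
  let L : Matrix ι Unit ℝ := Matrix.of fun i _ => v i
  have h1 : (Matrix.fromBlocks 1 R L A).det = (Matrix.of fun i j => A i j + v i * v j).det := by
    rw [Matrix.det_fromBlocks_one₁₁]
    congr 1
    ext i j
    simp [L, R, Matrix.mul_apply]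
  have h2 : (Matrix.fromBlocks 0 R L A).det = 0 := by
    apply det_skew_odd
    · rw [Matrix.fromBlocks_transpose, hA, Matrix.fromBlocks_neg]
      congr 1
      · simp
      · ext; simp [L, R]
    · simpa [add_comm] using he.add_one
  have h3 : (Matrix.fromBlocks (1 : Matrix Unit Unit ℝ) 0 L A).det = A.det := by
    rw [Matrix.det_fromBlocks_zero₁₂]; simp
  have e1 : Matrix.fromBlocks (1 : Matrix Unit Unit ℝ) R L A =
      (Matrix.fromBlocks (1 : Matrix Unit Unit ℝ) R L A).updateRow (Sum.inl ())
        ((Sum.elim (fun _ => 0) (fun j => - v j)) + (Sum.elim (fun _ => 1) (fun _ => 0))) := by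
    ext (i | i) (j | j) <;> simp [Matrix.updateRow_apply, R]
  rw [← h1, e1, Matrix.det_updateRow_add, ← h3]
  have e2 : (Matrix.fromBlocks (1 : Matrix Unit Unit ℝ) R L A).updateRow (Sum.inl ())
        (Sum.elim (fun _ => 0) (fun j => - v j)) = Matrix.fromBlocks 0 R L A := by
    ext (i | i) (j | j) <;> simp [Matrix.updateRow_apply, R]
  have e3 : (Matrix.fromBlocks (1 : Matrix Unit Unit ℝ) R L A).updateRow (Sum.inl ())
        (Sum.elim (fun _ => 1) (fun _ => 0)) = Matrix.fromBlocks 1 0 L A := by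
    ext (i | i) (j | j) <;> simp [Matrix.updateRow_apply]
  rw [e2, e3, h2, zero_add]

lemma sc1 (b x y K : ℝ) (hx : x ≠ 0) (hy : y ≠ 0) (h1 : 1 + b * x ≠ 0) (h2 : 1 + b * y ≠ 0)
    (hr : x^3 * (1 - b^2 * y^2) = -y^3 * (1 - b^2 * x^2)) :
    -K * (2 * y^2 / x) * ((1 - b * x) / (1 + b * y)) =
      -(-K * (2 * x^2 / y) * ((1 - b * y) / (1 + b * x))) := by
  have h : (2 * y^2 * (1 - b * x)) / (x * (1 + b * y)) =
      (-(2 * x^2 * (1 - b * y))) / (y * (1 + b * x)) := by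
    rw [div_eq_div_iff (mul_ne_zero hx h2) (mul_ne_zero hy h1)]
    linear_combination 2 * hr
  rw [mul_assoc, mul_assoc, div_mul_div_comm, div_mul_div_comm, h]
  ring

lemma sc2 (b x y K u w : ℝ) (hx : x ≠ 0) (hy : y ≠ 0) (h1 : 1 + b * x ≠ 0) (h2 : 1 - b * y ≠ 0)
    (h3 : x + y ≠ 0) :
    -K * (2 * x^2 / y) * ((1 - b * y) / (1 + b * x)) + (x - y) / (x + y) * u * w + u * w =
    -2 * x^2 / (1 + b * x) * ((1 - b * y) / y *
      (K - y / x * ((1 + b * x) / (1 - b * y)) * (u * w) / (x + y))) := by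
  generalize hd : 1 + b * x = d at *
  generalize he : 1 - b * y = e at *
  field_simp
  ring

/-- Second identity of Lemma 2.2: `τ_l² = c' f_l`. -/
theorem stmt5
    (N : ℕ) (hN : 1 ≤ N) (b : ℝ) (hb : b ≠ 0)
    (p : Fin (2*N) → ℝ) (hp0 : ∀ i, p i ≠ 0)
    (hpsum : ∀ i j, p i + p j ≠ 0)
    (hbm : ∀ i, 1 - b * p i ≠ 0) (hbp : ∀ i, 1 + b * p i ≠ 0)
    (ξ : Fin (2*N) → ℝ)
    (φ : Fin (2*N) → ℤ → ℤ → ℝ → ℝ)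
    (hφ : ∀ i n l s, φ i n l s =
      p i ^ n * ((1 + b * p i) / (1 - b * p i)) ^ l * Real.exp (s / p i + ξ i))
    (c : Fin (2*N) → ℝ) (hc : ∀ i, c i.rev = c i)
    (C : Matrix (Fin (2*N)) (Fin (2*N)) ℝ)
    (hC : ∀ i j, C i j = if j = i.rev then c i else 0)
    (cc : Matrix (Fin (2*N)) (Fin (2*N)) ℝ)
    (hcc : ∀ i j, cc i j = -C i j * (2 * (p i)^2 / p j) * ((1 - b * p j) / (1 + b * p i)))
    (hred : ∀ i, (p i)^3 * (1 - b^2 * (p i.rev)^2) = -(p i.rev)^3 * (1 - b^2 * (p i)^2))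
    (f : ℤ → ℝ → ℝ)
    (hf : ∀ l s, f l s =
      Matrix.det (Matrix.of fun i j =>
        C i j - (p j / p i) * ((1 + b * p i) / (1 - b * p j)) *
          (φ i 0 l s * φ j 0 l s) / (p i + p j)))
    (τ : ℤ → ℝ → ℝ)
    (hτ : ∀ l s, τ l s = pfaffian N (Matrix.of fun i j =>
      cc i j + ((p i - p j) / (p i + p j)) * φ i 0 l s * φ j 0 l s))
    (l : ℤ) (s : ℝ) :
    (τ l s)^2 = (∏ i, 2 * p i * ((1 - b * p i) / (1 + b * p i))) * f l s := by
  rw [hτ, hf]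
  generalize hv : (fun i => φ i 0 l s) = v
  have hv' : ∀ i, φ i 0 l s = v i := fun i => by rw [← hv]
  simp only [hv']
  have hCs : ∀ i j, C j i = C i j := by
    intro i j
    rw [hC, hC]
    by_cases h : j = i.rev
    · subst h; simp [hc]
    · have : i ≠ j.rev := by rintro rfl; simp at h
      rw [if_neg h, if_neg this]
  have hskew : ∀ i j, cc j i = - cc i j := by
    intro i j
    rw [hcc, hcc, hCs i j]
    by_cases h : j = i.rev
    · have hr := hred i
      rw [← h] at hr
      exact sc1 b (p i) (p j) _ (hp0 i) (hp0 j) (hbp i) (hbp j) hr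
    · rw [hC i j, if_neg h]; simp
  have hA : ∀ i j, (Matrix.of fun i j => cc i j + ((p i - p j) / (p i + p j)) * v i * v j :
      Matrix (Fin (2*N)) (Fin (2*N)) ℝ) j i =
      - (Matrix.of fun i j => cc i j + ((p i - p j) / (p i + p j)) * v i * v j :
      Matrix (Fin (2*N)) (Fin (2*N)) ℝ) i j := by
    intro i j
    simp only [Matrix.of_apply, hskew i j]
    rw [add_comm (p j) (p i)]
    ring
  rw [pf_sq N _ hA, ← det_skew_rank1 _ v (by ext i j; exact hA i j) (by simp)]
  have hprod : (∏ i, 2 * p i * ((1 - b * p i) / (1 + b * p i))) =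
      (∏ i, (-2 * (p i)^2 / (1 + b * p i))) * ∏ j, ((1 - b * p j) / p j) := by
    rw [← Finset.prod_mul_distrib]
    have h1 : ∏ i : Fin (2*N), (-1 : ℝ) = 1 := by simp [pow_mul]
    rw [← one_mul (∏ i, 2 * p i * _), ← h1, ← Finset.prod_mul_distrib]
    refine Finset.prod_congr rfl fun i _ => ?_
    have := hp0 i
    have := hbp i
    field_simp
  rw [hprod, mul_assoc, ← Matrix.det_mul_row, ← Matrix.det_mul_column]
  congr 1
  ext i j
  simp only [Matrix.of_apply]
  rw [hcc]
  exact sc2 b (p i) (p j) _ _ _ (hp0 i) (hp0 j) (hbp i) (hbm j) (hpsum i j)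
end

section
/- Under the reduction data, the Pfaffian tau functions satisfy the single-variable bilinear equation (D_s³ - 3b D_s² + 2b² D_s) τ_{l+1}·τ_l = 0 for every integer l and all real s, r, where all Hirota operators act in the variable s. (Equation (3.20) of the paper.) -/
/-- Partial derivative in the first variable `s` of a function of `(s, r)`. -/
noncomputable def dS (f : ℝ → ℝ → ℝ) : ℝ → ℝ → ℝ := fun s r => deriv (fun t => f t r) s


open Matrix in
theorem pf_conj (n : ℕ) (B A : Matrix (Fin (2*n)) (Fin (2*n)) ℝ) :
    pfaffian n (B * A * Bᵀ) = B.det * pfaffian n A := by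
  have key : ∀ (h : (Fin (2*n) → Fin (2*n)) → ℝ),
      ∑ σ : Equiv.Perm (Fin (2*n)), ((Equiv.Perm.sign σ : ℤ) : ℝ) *
        ∑ f : Fin (2*n) → Fin (2*n), h f * ∏ i, B (σ i) (f i) =
      B.det * ∑ σ : Equiv.Perm (Fin (2*n)), ((Equiv.Perm.sign σ : ℤ) : ℝ) * h σ := by
    intro h
    have h1 : ∀ f : Fin (2*n) → Fin (2*n), 
        ∑ σ : Equiv.Perm (Fin (2*n)), ((Equiv.Perm.sign σ : ℤ) : ℝ) * ∏ i, B (σ i) (f i)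
          = (B.submatrix id f).det := by
      intro f
      rw [Matrix.det_apply']
      rfl
    simp_rw [Finset.mul_sum]
    rw [Finset.sum_comm]
    have h2 : ∀ f : Fin (2*n) → Fin (2*n),
        ∑ σ : Equiv.Perm (Fin (2*n)), ((Equiv.Perm.sign σ : ℤ) : ℝ) * (h f * ∏ i, B (σ i) (f i))
          = h f * (B.submatrix id f).det := by
      intro f
      rw [← h1, Finset.mul_sum]
      exact Finset.sum_congr rfl fun _ _ => by ring
    simp_rw [h2]
    rw [← Finset.sum_subset (Finset.subset_univ
      (Finset.univ.image (fun σ : Equiv.Perm (Fin (2*n)) => (σ : Fin (2*n) → Fin (2*n)))))]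
    · rw [Finset.sum_image (fun a _ b _ hab => DFunLike.coe_injective hab)]
      refine Finset.sum_congr rfl fun σ _ => ?_
      rw [Matrix.det_permute']
      ring
    · intro f _ hf
      have hni : ¬ Function.Injective f := by
        intro hi
        apply hf
        simp only [Finset.mem_image, Finset.mem_univ, true_and]
        exact ⟨Equiv.ofBijective f (Finite.injective_iff_bijective.mp hi), rfl⟩
      rw [Function.not_injective_iff] at hni
      obtain ⟨a, b, hab, hne⟩ := hni
      rw [Matrix.det_zero_of_column_eq hne (by intro k; simp [hab]), mul_zero]
  unfold pfaffian
  have key2 := key (fun f => ∏ k : Fin n, A (f ⟨2*(k:ℕ), by have := k.isLt; omega⟩)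
        (f ⟨2*(k:ℕ)+1, by have := k.isLt; omega⟩))
  rw [mul_left_comm, ← key2]
  congr 1
  refine Finset.sum_congr rfl fun σ _ => ?_
  congr 1
  -- expand the product
  let e : Fin n × Fin 2 ≃ Fin (2*n) :=
    (finProdFinEquiv (m := n) (n := 2)).trans (finCongr (mul_comm n 2))
  have e0 : ∀ k : Fin n, e (k, 0) = ⟨2*(k:ℕ), by have := k.isLt; omega⟩ := by
    intro k; ext; simp [e, finProdFinEquiv]
  have e1 : ∀ k : Fin n, e (k, 1) = ⟨2*(k:ℕ)+1, by have := k.isLt; omega⟩ := by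
    intro k; ext; simp [e, finProdFinEquiv]; ring
  simp_rw [← e0, ← e1]
  have h3 : ∀ i j, (B * A * Bᵀ) i j = ∑ x : Fin 2 → Fin (2*n), A (x 0) (x 1) * ∏ t, B (![i,j] t) (x t) := by
    intro i j
    rw [← (finTwoArrowEquiv (Fin (2*n))).symm.sum_comp, Fintype.sum_prod_type]
    simp only [Matrix.mul_apply, Matrix.transpose_apply, Finset.sum_mul]
    rw [Finset.sum_comm]
    refine Finset.sum_congr rfl fun x _ => Finset.sum_congr rfl fun y _ => ?_
    simp [Fin.prod_univ_two]
    ring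
  simp_rw [h3]
  rw [Finset.prod_univ_sum, Fintype.piFinset_univ]
  let E : (Fin n → Fin 2 → Fin (2*n)) ≃ (Fin (2*n) → Fin (2*n)) :=
    (Equiv.curry (Fin n) (Fin 2) (Fin (2*n))).symm.trans (e.arrowCongr (Equiv.refl _))
  rw [← E.sum_comp]
  refine Finset.sum_congr rfl fun x _ => ?_
  have hE : ∀ k t, E x (e (k,t)) = x k t := by
    intro k t; simp [E, Equiv.arrowCongr]
  rw [Finset.prod_mul_distrib]
  congr 1
  · simp [hE]
  · rw [← e.prod_comp, Fintype.prod_prod_type]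
    refine Finset.prod_congr rfl fun k _ => ?_
    simp [Fin.prod_univ_two, hE]

open Matrix in
theorem pf_rank2 (n : ℕ) (A : Matrix (Fin (2*n)) (Fin (2*n)) ℝ) (hA : Aᵀ = -A)
    (hd : IsUnit A.det) (u v : Fin (2*n) → ℝ) :
    pfaffian n (A + vecMulVec u v - vecMulVec v u) =
      (1 + v ⬝ᵥ (A⁻¹ *ᵥ u)) * pfaffian n A := by
  have h := pf_conj n (1 + vecMulVec u (v ᵥ* A⁻¹)) A
  have hAy : A *ᵥ (v ᵥ* A⁻¹) = -v := by
    have h1 : A *ᵥ (v ᵥ* A⁻¹) = (v ᵥ* A⁻¹) ᵥ* Aᵀ := by rw [Matrix.vecMul_transpose]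
    rw [h1, hA, Matrix.vecMul_neg, Matrix.vecMul_vecMul, Matrix.nonsing_inv_mul _ hd, Matrix.vecMul_one]
  have hyA : (v ᵥ* A⁻¹) ᵥ* A = v := by
    rw [Matrix.vecMul_vecMul, Matrix.nonsing_inv_mul _ hd, Matrix.vecMul_one]
  have hinv : (A⁻¹)ᵀ = -A⁻¹ := by
    rw [Matrix.transpose_nonsing_inv, hA]
    refine Matrix.inv_eq_left_inv ?_
    simp [Matrix.nonsing_inv_mul _ hd]
  have hvv : v ⬝ᵥ (v ᵥ* A⁻¹) = 0 := by
    have h1 : v ⬝ᵥ (v ᵥ* A⁻¹) = - (v ⬝ᵥ (v ᵥ* A⁻¹)) := by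
      conv_lhs => rw [dotProduct_comm, ← Matrix.dotProduct_mulVec, ← Matrix.vecMul_transpose, hinv]
      simp [Matrix.vecMul_neg]
    linarith
  have hdet : (1 + vecMulVec u (v ᵥ* A⁻¹)).det = 1 + v ⬝ᵥ (A⁻¹ *ᵥ u) := by
    rw [Matrix.vecMulVec_eq Unit, Matrix.det_one_add_replicateCol_mul_replicateRow,
      Matrix.dotProduct_mulVec]
  rw [hdet] at h
  rw [← h]
  congr 1
  rw [Matrix.transpose_add, Matrix.transpose_one, Matrix.transpose_vecMulVec, Matrix.add_mul, 
    Matrix.one_mul, Matrix.vecMulVec_mul, hyA, Matrix.mul_add, Matrix.mul_one, Matrix.mul_vecMulVec,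
    Matrix.add_mulVec, hAy, Matrix.vecMulVec_mulVec, hvv]
  simp [Matrix.neg_vecMulVec, sub_eq_add_neg]

theorem skew_inv {m : Type*} [Fintype m] [DecidableEq m] (A : Matrix m m ℝ)
    (hA : A.transpose = -A) (hd : IsUnit A.det) : (A⁻¹).transpose = -A⁻¹ := by
  rw [Matrix.transpose_nonsing_inv, hA]
  refine Matrix.inv_eq_left_inv ?_
  simp [Matrix.nonsing_inv_mul _ hd]

section
attribute [local instance] Matrix.linftyOpNormedRing Matrix.linftyOpNormedAlgebra
theorem inv_deriv {m : Type*} [Fintype m] [DecidableEq m] (A : ℝ → Matrix m m ℝ)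
    (A' : Matrix m m ℝ) (s : ℝ) (h : ∀ i j, HasDerivAt (fun t => A t i j) (A' i j) s)
    (hd : IsUnit (A s).det) (i j : m) :
    HasDerivAt (fun t => (A t)⁻¹ i j) ((-((A s)⁻¹ * A' * (A s)⁻¹)) i j) s := by
  have h1 : HasDerivAt A A' s := by
    have h2 : HasDerivAt (fun t => ∑ i, ∑ j, (A t i j) • Matrix.single i j (1:ℝ))
        (∑ i, ∑ j, (A' i j) • Matrix.single i j (1:ℝ)) s := by
      refine HasDerivAt.fun_sum fun i _ => HasDerivAt.fun_sum fun j _ => ?_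
      exact (h i j).smul_const _
    convert h2 using 1
    · ext t i j
      conv_lhs => rw [Matrix.matrix_eq_sum_single (A t)]
      simp
    · conv_lhs => rw [Matrix.matrix_eq_sum_single A']
      simp
  obtain ⟨u, hu⟩ := (Matrix.isUnit_iff_isUnit_det _).mpr hd
  have h3 := hasFDerivAt_ringInverse (𝕜 := ℝ) u
  rw [hu] at h3
  have h4 := h3.comp_hasDerivAt s h1
  have h5 : (↑u⁻¹ : Matrix m m ℝ) = (A s)⁻¹ := by
    rw [Matrix.coe_units_inv, hu]
  have hf : (fun t => (A t)⁻¹) = Ring.inverse ∘ A := by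
    funext t
    simp [Matrix.nonsing_inv_eq_ringInverse]
  have hv : -((A s)⁻¹ * A' * (A s)⁻¹) =
      (-((ContinuousLinearMap.mulLeftRight ℝ (Matrix m m ℝ)) ↑u⁻¹) ↑u⁻¹) A' := by
    simp [h5]
  have h6 : HasDerivAt (fun t => (A t)⁻¹) (-((A s)⁻¹ * A' * (A s)⁻¹)) s := by
    rw [hf, hv]; exact h4
  let L : Matrix m m ℝ →L[ℝ] ℝ := LinearMap.toContinuousLinearMap (Matrix.entryLinearMap ℝ ℝ i j)
  exact L.hasFDerivAt.comp_hasDerivAt s h6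
end

theorem pf_deriv (n : ℕ) (A : ℝ → Matrix (Fin (2*n)) (Fin (2*n)) ℝ) (u v : Fin (2*n) → ℝ) (s : ℝ)
    (hA : (A s).transpose = -(A s)) (hd : IsUnit (A s).det)
    (h : ∀ i j, HasDerivAt (fun t => A t i j) (u i * v j - v i * u j) s) :
    HasDerivAt (fun t => pfaffian n (A t))
      ((v ⬝ᵥ ((A s)⁻¹.mulVec u)) * pfaffian n (A s)) s := by
  let P : (Fin (2*n) → Fin (2*n) → ℝ) → ℝ := fun B => pfaffian n (Matrix.of B)
  let D : Fin (2*n) → Fin (2*n) → ℝ := fun i j => u i * v j - v i * u j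
  let A0 : Fin (2*n) → Fin (2*n) → ℝ := fun i j => A s i j
  have hP : Differentiable ℝ P := by
    unfold P pfaffian
    simp only [Matrix.of_apply]
    fun_prop
  have h1 : HasDerivAt (fun t => (fun i j => A t i j : Fin (2*n) → Fin (2*n) → ℝ)) D s :=
    hasDerivAt_pi.mpr fun i => hasDerivAt_pi.mpr fun j => h i j
  have h2 : HasDerivAt (fun t => pfaffian n (A t)) (fderiv ℝ P A0 D) s := by
    have h5 : HasFDerivAt P (fderiv ℝ P A0) A0 := (hP A0).hasFDerivAt
    exact HasFDerivAt.comp_hasDerivAt (f := fun t => (fun i j => A t i j)) s h5 h1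
  have h3 : HasDerivAt (fun t : ℝ => A0 + t • D) D 0 := by
    have := ((hasDerivAt_id (0:ℝ)).smul_const D).const_add A0
    simpa using this
  have h4 : HasDerivAt (fun t : ℝ => P (A0 + t • D)) (fderiv ℝ P A0 D) 0 := by
    have h5 : HasFDerivAt P (fderiv ℝ P A0) (A0 + (0:ℝ) • D) := by
      simpa using (hP A0).hasFDerivAt
    exact h5.comp_hasDerivAt (0:ℝ) h3
  have h6 : (fun t : ℝ => P (A0 + t • D)) =
      fun t => (1 + t * (v ⬝ᵥ ((A s)⁻¹.mulVec u))) * pfaffian n (A s) := by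
    funext t
    have := pf_rank2 n (A s) hA hd u (t • v)
    rw [smul_dotProduct, smul_eq_mul] at this
    rw [← this]
    unfold P
    congr 1
    ext i j
    simp [A0, D, Matrix.vecMulVec_apply]
    ring
  rw [h6] at h4
  have h7 : HasDerivAt (fun t : ℝ => (1 + t * (v ⬝ᵥ ((A s)⁻¹.mulVec u))) * pfaffian n (A s))
      ((v ⬝ᵥ ((A s)⁻¹.mulVec u)) * pfaffian n (A s)) 0 := by
    have := (((hasDerivAt_id (0:ℝ)).mul_const (v ⬝ᵥ ((A s)⁻¹.mulVec u))).const_add 1).mul_const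
      (pfaffian n (A s))
    simpa using this
  rw [← h4.unique h7]
  exact h2

theorem br_deriv {m : Type*} [Fintype m] [DecidableEq m] (A : ℝ → Matrix m m ℝ)
    (u v : m → ℝ) (s : ℝ) (h : ∀ i j, HasDerivAt (fun t => A t i j) (u i * v j - v i * u j) s)
    (hd : IsUnit (A s).det) (x y : ℝ → m → ℝ) (x' y' : m → ℝ)
    (hx : ∀ i, HasDerivAt (fun t => x t i) (x' i) s)
    (hy : ∀ i, HasDerivAt (fun t => y t i) (y' i) s) :
    HasDerivAt (fun t => x t ⬝ᵥ ((A t)⁻¹.mulVec (y t)))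
      (x' ⬝ᵥ ((A s)⁻¹.mulVec (y s)) + x s ⬝ᵥ ((A s)⁻¹.mulVec y')
       - (x s ⬝ᵥ ((A s)⁻¹.mulVec u)) * (v ⬝ᵥ ((A s)⁻¹.mulVec (y s)))
       + (x s ⬝ᵥ ((A s)⁻¹.mulVec v)) * (u ⬝ᵥ ((A s)⁻¹.mulVec (y s)))) s := by
  have hM := inv_deriv A (Matrix.vecMulVec u v - Matrix.vecMulVec v u) s
    (by intro i j; simpa [Matrix.vecMulVec_apply] using h i j) hd
  have h1 : HasDerivAt (fun t => ∑ i, x t i * ∑ j, (A t)⁻¹ i j * y t j)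
      (∑ i, (x' i * ∑ j, (A s)⁻¹ i j * y s j + x s i * ∑ j, 
        ((-((A s)⁻¹ * (Matrix.vecMulVec u v - Matrix.vecMulVec v u) * (A s)⁻¹)) i j * y s j
          + (A s)⁻¹ i j * y' j))) s := by
    refine HasDerivAt.fun_sum fun i _ => (hx i).mul (HasDerivAt.fun_sum fun j _ => (hM i j).mul (hy j))
  refine HasDerivAt.congr_deriv h1 ?_
  have h2 : ∑ i, (x' i * ∑ j, (A s)⁻¹ i j * y s j + x s i * ∑ j, 
        ((-((A s)⁻¹ * (Matrix.vecMulVec u v - Matrix.vecMulVec v u) * (A s)⁻¹)) i j * y s j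
          + (A s)⁻¹ i j * y' j)) = 
      x' ⬝ᵥ ((A s)⁻¹.mulVec (y s)) + x s ⬝ᵥ ((A s)⁻¹.mulVec y') + 
      x s ⬝ᵥ ((-((A s)⁻¹ * (Matrix.vecMulVec u v - Matrix.vecMulVec v u) * (A s)⁻¹)).mulVec (y s)) := by
    simp only [dotProduct, Matrix.mulVec, Finset.sum_add_distrib, mul_add]
    ring
  rw [h2]
  simp only [Matrix.neg_mulVec, Matrix.mul_sub, Matrix.sub_mul, Matrix.sub_mulVec, 
    Matrix.mul_vecMulVec, Matrix.vecMulVec_mul, Matrix.vecMulVec_mulVec, dotProduct_neg, dotProduct_sub,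
    ← Matrix.dotProduct_mulVec, dotProduct_smul, MulOpposite.smul_eq_mul_unop, MulOpposite.unop_op]
  ring

theorem core (N : ℕ) (b : ℝ) (q : Fin (2*N) → ℝ) (hq : ∀ i j, q i + q j ≠ 0)
    (hqb : ∀ i, q i - b ≠ 0) (K : Matrix (Fin (2*N)) (Fin (2*N)) ℝ) (hK : ∀ i j, K j i = - K i j)
    (hW : ∀ i j, K i j * ((q i ^ 3 - b^2 * q i) + (q j ^ 3 - b^2 * q j)) = 0)
    (f g : ℝ → Fin (2*N) → ℝ) (hf : ∀ s i, HasDerivAt (fun t => f t i) (q i * f s i) s)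
    (hg : ∀ s i, g s i = (q i + b) / (q i - b) * f s i)
    (A : ℝ → Matrix (Fin (2*N)) (Fin (2*N)) ℝ)
    (hA : ∀ t i j, A t i j = K i j + (q j - q i) / (q i + q j) * f t i * f t j)
    (A1 : ℝ → Matrix (Fin (2*N)) (Fin (2*N)) ℝ)
    (hA1 : ∀ t i j, A1 t i j = K i j + (q j - q i) / (q i + q j) * g t i * g t j)
    (T T1 : ℝ → ℝ) (hT : ∀ t, T t = pfaffian N (A t)) (hT1 : ∀ t, T1 t = pfaffian N (A1 t))
    (s : ℝ) (hd : (A s).det ≠ 0) :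
    (deriv (deriv (deriv T1)) s * T s
          - 3 * deriv (deriv T1) s * deriv T s
          + 3 * deriv T1 s * deriv (deriv T) s
          - T1 s * deriv (deriv (deriv T)) s)
        - 3 * b * (deriv (deriv T1) s * T s
          - 2 * deriv T1 s * deriv T s
          + T1 s * deriv (deriv T) s)
        + 2 * b^2 * (deriv T1 s * T s - T1 s * deriv T s) = 0 := by
  let X : ℕ → ℝ → Fin (2*N) → ℝ := fun m t i => q i ^ m * f t i
  let Y : ℝ → Fin (2*N) → ℝ := fun t i => f t i / (q i - b)
  let a : ℕ → ℕ → ℝ → ℝ := fun m n t => X m t ⬝ᵥ ((A t)⁻¹.mulVec (X n t))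
  let h : ℕ → ℝ → ℝ := fun m t => X m t ⬝ᵥ ((A t)⁻¹.mulVec (Y t))
  let U : Set ℝ := {t | (A t).det ≠ 0}
  have hAd : ∀ t i j, HasDerivAt (fun t => A t i j) (X 0 t i * X 1 t j - X 1 t i * X 0 t j) t := by
    intro t i j
    have h1 : (fun t => A t i j) = fun t => K i j + (q j - q i) / (q i + q j) * f t i * f t j := by
      funext t; exact hA t i j
    rw [h1]
    have h2 := (((hf t i).const_mul ((q j - q i) / (q i + q j))).mul (hf t j)).const_add (K i j)
    refine h2.congr_deriv ?_
    simp only [X]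
    have := hq i j
    field_simp
  have hXd : ∀ m t i, HasDerivAt (fun t => X m t i) (X (m+1) t i) t := by
    intro m t i
    refine ((hf t i).const_mul (q i ^ m)).congr_deriv ?_
    simp only [X]; ring
  have hYd : ∀ t i, HasDerivAt (fun t => Y t i) ((X 0 t + b • Y t) i) t := by
    intro t i
    refine ((hf t i).div_const (q i - b)).congr_deriv ?_
    have := hqb i
    simp only [X, Y, Pi.add_apply, Pi.smul_apply, smul_eq_mul]
    field_simp
    try ring
  have hskew : ∀ t, (A t).transpose = -(A t) := by
    intro t
    ext i j
    simp only [Matrix.transpose_apply, Matrix.neg_apply, hA, hK i j]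
    have := hq i j
    have := hq j i
    field_simp
    try ring
  have hU : IsOpen U := by
    have hc : Continuous fun t => (A t).det := by
      refine Continuous.matrix_det ?_
      refine continuous_matrix fun i j => ?_
      exact continuous_iff_continuousAt.mpr fun t => (hAd t i j).continuousAt
    exact isOpen_ne_fun hc continuous_const
  have hUu : ∀ t ∈ U, IsUnit (A t).det := fun t ht => isUnit_iff_ne_zero.mpr ht
  have hbs : ∀ t ∈ U, ∀ x y : Fin (2*N) → ℝ, 
      x ⬝ᵥ ((A t)⁻¹.mulVec y) = - (y ⬝ᵥ ((A t)⁻¹.mulVec x)) := by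
    intro t ht x y
    rw [dotProduct_comm, ← Matrix.vecMul_transpose, skew_inv _ (hskew t) (hUu t ht),
      ← Matrix.dotProduct_mulVec, Matrix.neg_mulVec, dotProduct_neg]
  have has : ∀ t ∈ U, ∀ m n, a m n t = - a n m t := fun t ht m n => hbs t ht _ _
  have ha0 : ∀ t ∈ U, ∀ m, a m m t = 0 := by
    intro t ht m
    have := has t ht m m
    linarith
  have had : ∀ t ∈ U, ∀ m n, HasDerivAt (a m n)
      (a (m+1) n t + a m (n+1) t - a m 0 t * a 1 n t + a m 1 t * a 0 n t) t := by
    intro t ht m n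
    exact br_deriv A (X 0 t) (X 1 t) t (hAd t) (hUu t ht) (X m) (X n) _ _ (hXd m t) (hXd n t)
  have hhd : ∀ t ∈ U, ∀ m, HasDerivAt (h m)
      (h (m+1) t + (a m 0 t + b * h m t) - a m 0 t * h 1 t + a m 1 t * h 0 t) t := by
    intro t ht m
    refine (br_deriv A (X 0 t) (X 1 t) t (hAd t) (hUu t ht) (X m) Y _ _ (hXd m t) (hYd t)).congr_deriv ?_
    simp only [Matrix.mulVec_add, dotProduct_add, Matrix.mulVec_smul, dotProduct_smul, smul_eq_mul, a, h]
  have hTd : ∀ t ∈ U, HasDerivAt T (T t * a 1 0 t) t := by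
    intro t ht
    have h1 := pf_deriv N A (X 0 t) (X 1 t) t (hskew t) (hUu t ht) (hAd t)
    have h2 : T = fun t => pfaffian N (A t) := funext hT
    rw [h2]
    refine h1.congr_deriv ?_
    simp only [a]; ring
  have hT1e : ∀ t ∈ U, T1 t = T t * (1 + 2 * b * h 0 t) := by
    intro t ht
    have h1 := pf_rank2 N (A t) (hskew t) (hUu t ht) (Y t) ((2*b) • X 0 t)
    rw [hT1, hT]
    rw [smul_dotProduct, smul_eq_mul] at h1
    rw [mul_comm (pfaffian N (A t))]
    refine Eq.trans ?_ h1
    congr 1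
    ext i j
    simp only [Matrix.sub_apply, Matrix.add_apply, Matrix.vecMulVec_apply, hA1, hA, hg, X, Y, 
      Pi.smul_apply, smul_eq_mul]
    have := hq i j
    have := hqb i
    have := hqb j
    field_simp
    ring
  have step : ∀ (F F' G : ℝ → ℝ), (∀ t ∈ U, F t = G t) → (∀ t ∈ U, HasDerivAt G (F' t) t) →
      ∀ t ∈ U, deriv F t = F' t := by
    intro F F' G h1 h2 t ht
    have : F =ᶠ[nhds t] G := Filter.eventually_of_mem (hU.mem_nhds ht) h1
    rw [this.deriv_eq]
    exact (h2 t ht).deriv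
  have t1 : ∀ t ∈ U, deriv T t = T t * a 1 0 t := fun t ht => (hTd t ht).deriv
  have t2 : ∀ t ∈ U, deriv (deriv T) t = T t * a 2 0 t := by
    refine step _ _ _ t1 fun t ht => ?_
    refine ((hTd t ht).mul (had t ht 1 0)).congr_deriv ?_
    rw [ha0 t ht 1, ha0 t ht 0]
    ring
  have t3 : ∀ t ∈ U, deriv (deriv (deriv T)) t = T t * (a 3 0 t + a 2 1 t) := by
    refine step _ _ _ t2 fun t ht => ?_
    refine ((hTd t ht).mul (had t ht 2 0)).congr_deriv ?_
    simp only [Nat.reduceAdd]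
    rw [ha0 t ht 0]
    ring
  have s1 : ∀ t ∈ U, deriv T1 t = T t * (a 1 0 t + 2 * b * h 1 t + 2 * b^2 * h 0 t) := by
    refine step _ _ _ hT1e fun t ht => ?_
    refine ((hTd t ht).mul (((hhd t ht 0).const_mul (2*b)).const_add 1)).congr_deriv ?_
    simp only [Nat.reduceAdd]
    rw [ha0 t ht 0, has t ht 0 1]
    ring
  have s2 : ∀ t ∈ U, deriv (deriv T1) t = T t * (a 2 0 t + 2 * b * h 2 t + 2 * b * a 1 0 t
      + 4 * b^2 * h 1 t + 2 * b^3 * h 0 t) := by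
    refine step _ _ _ s1 fun t ht => ?_
    refine ((hTd t ht).mul (((had t ht 1 0).add ((hhd t ht 1).const_mul (2*b))).add
      ((hhd t ht 0).const_mul (2*b^2)))).congr_deriv ?_
    simp only [Nat.reduceAdd, Pi.add_apply]
    rw [ha0 t ht 0, ha0 t ht 1, has t ht 0 1]
    ring
  have s3 := step _ (fun t => _) _ s2 fun t ht => 
    (hTd t ht).mul (((((had t ht 2 0).add ((hhd t ht 2).const_mul (2*b))).add 
      ((had t ht 1 0).const_mul (2*b))).add ((hhd t ht 1).const_mul (4*b^2))).add
      ((hhd t ht 0).const_mul (2*b^3)))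
  have hs : s ∈ U := hd
  -- the reduction relation
  have red : -a 2 0 s - b * a 1 0 s + h 3 s - b^2 * h 1 s
      = a 3 0 s * h 0 s - 2 * a 2 0 s * h 1 s + 2 * a 1 0 s * h 2 s - b^2 * a 1 0 s * h 0 s := by
    let W : Matrix (Fin (2*N)) (Fin (2*N)) ℝ := Matrix.diagonal fun i => q i ^ 3 - b^2 * q i
    have hR : W * A s + A s * W = Matrix.vecMulVec (X 0 s) (X 3 s) - Matrix.vecMulVec (X 3 s) (X 0 s)
        + (2:ℝ) • (Matrix.vecMulVec (X 2 s) (X 1 s) - Matrix.vecMulVec (X 1 s) (X 2 s))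
        - (b^2) • (Matrix.vecMulVec (X 0 s) (X 1 s) - Matrix.vecMulVec (X 1 s) (X 0 s)) := by
      ext i j
      simp only [W, Matrix.add_apply, Matrix.sub_apply, Matrix.smul_apply, Matrix.diagonal_mul,
        Matrix.mul_diagonal, Matrix.vecMulVec_apply, smul_eq_mul, hA, X]
      have h1 := hq i j
      have h2 := hW i j
      have h3 : (q j - q i) / (q i + q j) * (q i + q j) = q j - q i := by field_simp
      generalize (q j - q i) / (q i + q j) = z at h3
      linear_combination h2 + f s i * f s j * (q i ^2 - q i * q j + q j^2 - b^2) * h3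
    have hI : (A s)⁻¹ * (W * A s + A s * W) * (A s)⁻¹ = (A s)⁻¹ * W + W * (A s)⁻¹ := by
      rw [Matrix.mul_add, Matrix.add_mul, ← Matrix.mul_assoc, ← Matrix.mul_assoc, 
        Matrix.nonsing_inv_mul _ (hUu s hs), Matrix.one_mul, Matrix.mul_assoc, 
        Matrix.mul_nonsing_inv _ (hUu s hs), Matrix.mul_one]
    have hWY : W.mulVec (Y s) = X 2 s + b • X 1 s := by
      ext i
      simp only [W, Matrix.mulVec_diagonal, X, Y, Pi.add_apply, Pi.smul_apply, smul_eq_mul]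
      have := hqb i
      field_simp
      ring
    have hWX : Matrix.vecMul (X 0 s) W = X 3 s - (b^2) • X 1 s := by
      ext i
      simp only [W, Matrix.vecMul_diagonal, X, Pi.sub_apply, Pi.smul_apply, smul_eq_mul]
      ring
    have hE := congrArg (fun M => X 0 s ⬝ᵥ (M.mulVec (Y s))) hI
    beta_reduce at hE
    rw [Matrix.add_mulVec, ← Matrix.mulVec_mulVec (Y s) (A s)⁻¹ W, ← Matrix.mulVec_mulVec (Y s) W (A s)⁻¹, hWY, dotProduct_add,
      Matrix.dotProduct_mulVec (X 0 s) W, hWX, hR] at hE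
    simp only [Matrix.mul_sub, Matrix.sub_mul, Matrix.mul_add, Matrix.add_mul, Matrix.sub_mulVec, 
      Matrix.add_mulVec, Matrix.mul_smul, Matrix.smul_mul, Matrix.smul_mulVec,
      Matrix.mul_vecMulVec, Matrix.vecMulVec_mul, Matrix.vecMulVec_mulVec, dotProduct_add,
      dotProduct_sub, sub_dotProduct, smul_dotProduct, Matrix.mulVec_add, Matrix.mulVec_smul,
      ← Matrix.dotProduct_mulVec, dotProduct_smul, MulOpposite.smul_eq_mul_unop, 
      MulOpposite.unop_op, smul_eq_mul] at hE
    have c00 := ha0 s hs 0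
    have c02 := has s hs 0 2
    have c01 := has s hs 0 1
    have c03 := has s hs 0 3
    change a 0 0 s * h 3 s - a 0 3 s * h 0 s + 2 * (a 0 2 s * h 1 s - a 0 1 s * h 2 s)
      - b^2 * (a 0 0 s * h 1 s - a 0 1 s * h 0 s) = a 0 2 s + b * a 0 1 s + (h 3 s - b^2 * h 1 s) at hE
    rw [c00, c01, c02, c03] at hE
    linear_combination -hE
  rw [s3 s hs, s2 s hs, s1 s hs, t3 s hs, t2 s hs, t1 s hs, hT1e s hs]
  simp only [Nat.reduceAdd]
  rw [ha0 s hs 0, ha0 s hs 1, has s hs 0 1]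
  linear_combination (2 * b * T s ^ 2) * red

theorem deriv_smooth (F : ℝ → ℝ → ℝ) (hF : ContDiff ℝ (⊤ : ℕ∞) (fun x : ℝ × ℝ => F x.1 x.2)) :
    ContDiff ℝ (⊤ : ℕ∞) (fun x : ℝ × ℝ => deriv (F x.1) x.2) := by
  have h1 : ∀ x : ℝ × ℝ, deriv (F x.1) x.2 = 
      fderiv ℝ (fun x : ℝ × ℝ => F x.1 x.2) x ((0:ℝ), (1:ℝ)) := by
    intro x
    have h2 : HasDerivAt (fun t : ℝ => ((x.1, t) : ℝ × ℝ)) ((0:ℝ),(1:ℝ)) x.2 :=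
      (hasDerivAt_const x.2 x.1).prodMk (hasDerivAt_id x.2)
    have h3 := (hF.differentiable (by simp) (x.1, x.2)).hasFDerivAt.comp_hasDerivAt x.2 h2
    exact h3.deriv
  simp_rw [h1]
  exact (hF.fderiv_right (m := (⊤ : ℕ∞)) (by simp)).clm_apply contDiff_const

theorem slice_cont (F : ℝ × ℝ → ℝ) (hF : ContDiff ℝ (⊤ : ℕ∞) F) (s : ℝ) :
    Continuous fun e : ℝ => F (e, s) := 
  hF.continuous.comp (by fun_prop)

theorem skew_alg (c b x y : ℝ) (hx : x ≠ 0) (hy : y ≠ 0) (h1 : 1 + b * x ≠ 0) (h2 : 1 + b * y ≠ 0)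
    (h : x^3 * (1 - b^2 * y^2) = -y^3 * (1 - b^2 * x^2)) :
    -c * (2 * y^2 / x) * ((1 - b * x) / (1 + b * y)) =
      -(-c * (2 * x^2 / y) * ((1 - b * y) / (1 + b * x))) := by
  have e1 : -c * (2 * y^2 / x) * ((1 - b * x) / (1 + b * y)) =
    (-c * (2 * y^2) * (1 - b * x)) / (x * (1 + b * y)) := by
    rw [← mul_div_assoc (-c), div_mul_div_comm]
  have e2 : -(-c * (2 * x^2 / y) * ((1 - b * y) / (1 + b * x))) =
    (c * (2 * x^2) * (1 - b * y)) / (y * (1 + b * x)) := by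
    rw [← mul_div_assoc (-c), div_mul_div_comm, ← neg_div]
    ring
  rw [e1, e2, div_eq_div_iff (mul_ne_zero hx h2) (mul_ne_zero hy h1)]
  linear_combination (-2 * c) * h

/-- Equation (3.20): under the reduction,
`(D_s³ - 3b D_s² + 2b² D_s) τ_{l+1}·τ_l = 0` (Hirota operators in `s`). -/
theorem stmt15
    (N : ℕ) (hN : 1 ≤ N) (b : ℝ) (hb : b ≠ 0)
    (p : Fin (2*N) → ℝ) (hp0 : ∀ i, p i ≠ 0)
    (hpsum : ∀ i j, p i + p j ≠ 0)
    (hbm : ∀ i, 1 - b * p i ≠ 0) (hbp : ∀ i, 1 + b * p i ≠ 0)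
    (ξ : Fin (2*N) → ℝ)
    (φ : Fin (2*N) → ℤ → ℝ → ℝ → ℝ)
    (hφ : ∀ i l s r, φ i l s r =
      ((1 + b * p i) / (1 - b * p i)) ^ l * Real.exp (s / p i + r / (p i)^3 + ξ i))
    (c : Fin (2*N) → ℝ) (hc : ∀ i, c i.rev = c i)
    (C : Matrix (Fin (2*N)) (Fin (2*N)) ℝ)
    (hC : ∀ i j, C i j = if j = i.rev then c i else 0)
    (cc : Matrix (Fin (2*N)) (Fin (2*N)) ℝ)
    (hcc : ∀ i j, cc i j = -C i j * (2 * (p i)^2 / p j) * ((1 - b * p j) / (1 + b * p i)))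
    (hred : ∀ i, (p i)^3 * (1 - b^2 * (p i.rev)^2) = -(p i.rev)^3 * (1 - b^2 * (p i)^2))
    (τ : ℤ → ℝ → ℝ → ℝ)
    (hτ : ∀ l s r, τ l s r = pfaffian N (Matrix.of fun i j =>
      cc i j + ((p i - p j) / (p i + p j)) * φ i l s r * φ j l s r)) :
    ∀ (l : ℤ) (s r : ℝ),
      (dS (dS (dS (τ (l+1)))) s r * τ l s r
          - 3 * dS (dS (τ (l+1))) s r * dS (τ l) s r
          + 3 * dS (τ (l+1)) s r * dS (dS (τ l)) s r
          - τ (l+1) s r * dS (dS (dS (τ l))) s r)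
        - 3 * b * (dS (dS (τ (l+1))) s r * τ l s r
          - 2 * dS (τ (l+1)) s r * dS (τ l) s r
          + τ (l+1) s r * dS (dS (τ l)) s r)
        + 2 * b^2 * (dS (τ (l+1)) s r * τ l s r - τ (l+1) s r * dS (τ l) s r) = 0 := by
  intro l s r
  have hq : ∀ i j, 1 / p i + 1 / p j ≠ 0 := by
    intro i j
    have h1 := hp0 i
    have h2 := hp0 j
    have h3 : 1 / p i + 1 / p j = (p i + p j) / (p i * p j) := by field_simp; ring
    rw [h3]
    exact div_ne_zero (hpsum i j) (mul_ne_zero h1 h2)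
  have hqb : ∀ i, 1 / p i - b ≠ 0 := by
    intro i
    have h1 := hp0 i
    have h3 : 1 / p i - b = (1 - b * p i) / p i := by field_simp
    rw [h3]
    exact div_ne_zero (hbm i) h1
  have hww : ∀ i : Fin (2*N), ((1 / p i)^3 - b^2 * (1 / p i)) +
      ((1 / p i.rev)^3 - b^2 * (1 / p i.rev)) = 0 := by
    intro i
    have h1 := hp0 i
    have h2 := hp0 i.rev
    have h3 := hred i
    field_simp
    linear_combination h3
  have hrev : ∀ i : Fin (2*N), i.rev ≠ i := by
    intro i h
    have := congrArg Fin.val h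
    rw [Fin.val_rev] at this
    have := i.isLt
    omega
  have hccs : ∀ i j, cc j i = - cc i j := by
    intro i j
    rw [hcc, hcc, hC, hC]
    by_cases hij : j = i.rev
    · subst hij
      simp only [Fin.rev_rev, if_true, hc]
      have h1 := hp0 i
      have h2 := hp0 i.rev
      have h3 := hbp i
      have h4 := hbp i.rev
      have h5 := hred i
      exact skew_alg _ _ _ _ h1 h2 h3 h4 h5
    · have hji : i ≠ j.rev := by
        rintro rfl
        simp at hij
      simp [hij, hji]
  let J : Matrix (Fin (2*N)) (Fin (2*N)) ℝ := Matrix.of fun i j =>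
    if j = i.rev then (if i < i.rev then 1 else -1) else 0
  have hJs : ∀ i j, J j i = - J i j := by
    intro i j
    simp only [J, Matrix.of_apply]
    by_cases hij : j = i.rev
    · subst hij
      simp only [Fin.rev_rev, if_true]
      rcases lt_or_gt_of_ne (hrev i) with h | h
      · simp [h, h.not_gt]
      · simp [h, h.not_gt]
    · have hji : i ≠ j.rev := by
        rintro rfl
        simp at hij
      simp [hij, hji]
  have hJJ : J * J = -1 := by
    ext i j
    rw [Matrix.mul_apply, Finset.sum_eq_single i.rev]
    · by_cases hij : i = j
      · subst hij
        rw [hJs i.rev i]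
        simp only [J, Matrix.of_apply, Fin.rev_rev, if_true, Matrix.neg_apply, Matrix.one_apply_eq]
        split_ifs <;> norm_num
      · have : j ≠ i := fun h => hij h.symm
        simp [J, hij, this]
    · intro k _ hk
      simp [J, hk]
    · simp
  let K : ℝ → Matrix (Fin (2*N)) (Fin (2*N)) ℝ := fun e => cc + e • J
  let A : ℤ → ℝ → ℝ → Matrix (Fin (2*N)) (Fin (2*N)) ℝ := fun l e t =>
    Matrix.of fun i j => K e i j + ((p i - p j) / (p i + p j)) * φ i l t r * φ j l t r
  let T : ℤ → ℝ → ℝ → ℝ := fun l e t => pfaffian N (A l e t)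
  have hT0 : ∀ l t, τ l t r = T l 0 t := by
    intro l t
    simp [T, A, K, hτ]
  have hsm : ∀ l, ContDiff ℝ (⊤ : ℕ∞) (fun x : ℝ × ℝ => T l x.1 x.2) := by
    intro l
    simp only [T, A, K, pfaffian, Matrix.of_apply, hφ, Matrix.add_apply, Matrix.smul_apply]
    fun_prop
  have hsm1 := fun l => deriv_smooth _ (hsm l)
  have hsm2 := fun l => deriv_smooth (fun e => deriv (T l e)) (hsm1 l)
  have hsm3 := fun l => deriv_smooth (fun e => deriv (deriv (T l e))) (hsm2 l)
  have c0 := fun l => slice_cont _ (hsm l) s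
  have c1 := fun l => slice_cont _ (hsm1 l) s
  have c2 := fun l => slice_cont _ (hsm2 l) s
  have c3 := fun l => slice_cont _ (hsm3 l) s
  simp only [] at c0 c1 c2 c3
  let F : ℝ → ℝ := fun e =>
    (deriv (deriv (deriv (T (l+1) e))) s * T l e s
          - 3 * deriv (deriv (T (l+1) e)) s * deriv (T l e) s
          + 3 * deriv (T (l+1) e) s * deriv (deriv (T l e)) s
          - T (l+1) e s * deriv (deriv (deriv (T l e))) s)
        - 3 * b * (deriv (deriv (T (l+1) e)) s * T l e s
          - 2 * deriv (T (l+1) e) s * deriv (T l e) s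
          + T (l+1) e s * deriv (deriv (T l e)) s)
        + 2 * b^2 * (deriv (T (l+1) e) s * T l e s - T (l+1) e s * deriv (T l e) s)
  have hFc : Continuous F := by
    have := c0 l
    have := c1 l
    have := c2 l
    have := c3 l
    have := c0 (l+1)
    have := c1 (l+1)
    have := c2 (l+1)
    have := c3 (l+1)
    simp only [F]
    fun_prop
  have hpq : ∀ i j, (p i - p j) / (p i + p j) = (1 / p j - 1 / p i) / (1 / p i + 1 / p j) := by
    intro i j
    have h1 := hp0 i
    have h2 := hp0 j
    have h3 := hpsum i j
    have h4 : 1 / p i + 1 / p j = (p i + p j) / (p i * p j) := by field_simp; ring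
    rw [h4]
    field_simp
  have hF0 : ∀ e, (A l e s).det ≠ 0 → F e = 0 := by
    intro e he
    refine core N b (fun i => 1 / p i) hq hqb (K e) ?_ ?_ (fun t i => φ i l t r)
      (fun t i => φ i (l+1) t r) ?_ ?_ (A l e) ?_ (A (l+1) e) ?_ (T l e) (T (l+1) e)
      (fun _ => rfl) (fun _ => rfl) s he
    · intro i j
      simp only [K, Matrix.add_apply, Matrix.smul_apply, smul_eq_mul, hccs i j, hJs i j]
      ring
    · intro i j
      by_cases hij : j = i.rev
      · subst hij
        rw [hww i, mul_zero]
      · have : K e i j = 0 := by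
          simp [K, J, hcc, hC, hij]
        rw [this, zero_mul]
    · intro t i
      simp only [hφ]
      have h1 : HasDerivAt (fun t : ℝ => t / p i + r / p i ^ 3 + ξ i) (1 / p i) t :=
        (((hasDerivAt_id t).div_const (p i)).add_const _).add_const _
      refine (h1.exp.const_mul _).congr_deriv ?_
      ring
    · intro t i
      simp only [hφ]
      have h1 := hp0 i
      have h2 := hbm i
      have h3 := hqb i
      have h4 : (1 / p i + b) / (1 / p i - b) = (1 + b * p i) / (1 - b * p i) := by
        have h5 : 1 / p i - b = (1 - b * p i) / p i := by field_simp
        rw [h5]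
        field_simp
      rw [h4, zpow_add_one₀ (div_ne_zero (hbp i) h2)]
      ring
    · intro t i j
      simp only [A, Matrix.of_apply, hpq]
    · intro t i j
      simp only [A, Matrix.of_apply, hpq]
  -- density
  have hdet : ∀ e, A l e s = J * (Matrix.scalar _ e - (J * A l 0 s)) := by
    intro e
    rw [Matrix.mul_sub, ← Matrix.mul_assoc, hJJ]
    ext i j
    simp [A, K]
    ring
  have hJd : J.det ≠ 0 := by
    intro h0
    have h1 := congrArg Matrix.det hJJ
    rw [Matrix.det_mul, h0, Matrix.det_neg] at h1
    simp at h1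
  have hfin : ({e | F e = 0}ᶜ : Set ℝ).Finite := by
    refine Set.Finite.subset ((J * A l 0 s).charpoly.roots.toFinset.finite_toSet) ?_
    intro e he
    have h1 : (A l e s).det = 0 := by
      by_contra h
      exact he (hF0 e h)
    rw [hdet, Matrix.det_mul, ← Matrix.eval_charpoly] at h1
    have h2 := (mul_eq_zero.mp h1).resolve_left hJd
    simp only [Finset.mem_coe, Multiset.mem_toFinset]
    exact (Polynomial.mem_roots (Matrix.charpoly_monic _).ne_zero).mpr h2
  have hdense : Dense {e | F e = 0} := by
    have := hfin.countable.dense_compl ℝ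
    rwa [compl_compl] at this
  have hF : F = fun _ => 0 := hFc.ext_on hdense continuous_const (fun e he => he)
  have hfinal : F 0 = 0 := congrFun hF 0
  have hτ' : ∀ l, (fun t => τ l t r) = T l 0 := fun l => funext (hT0 l)
  simp only [dS, hτ', hT0]
  exact hfinal
end
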